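/- arXiv:1201.0743 — 2 statements merged into one kernel-verified Lean document; each statement's English description precedes it below -/
import Mathlib

section
/- Let ρ > 0 and let j = (j₁,j₂) ∈ ℤ² satisfy λ_j ≠ 0. Then the function x ↦ G_{k,α}(x) · conj(φ_j(x)), which is defined for almost every x ∈ Ω_ρ (namely for all x with x₂ ≠ 0), is Lebesgue integrable on Ω_ρ, and ∫_{Ω_ρ} G_{k,α}(x) conj(φ_j(x)) dx = (cos(j₂π) e^{i β_{j₁} ρ} − 1) / (√(4πρ) · λ_j). -/
open MeasureTheory

/-- `β_n = (k² − (n+α)²)^{1/2}`, the principal complex square root: positive real when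
`k² > (n+α)²`, and `i((n+α)² − k²)^{1/2}` when `k² < (n+α)²`. -/
noncomputable def greenBeta (k α : ℝ) (n : ℤ) : ℂ :=
  if k ^ 2 < ((n : ℝ) + α) ^ 2 then
    Complex.I * (Real.sqrt (((n : ℝ) + α) ^ 2 - k ^ 2) : ℂ)
  else (Real.sqrt (k ^ 2 - ((n : ℝ) + α) ^ 2) : ℂ)

/-- The `n`-th term `(1/β_n) exp(i α_n x₁ + i β_n |x₂|)` of the series for `G_{k,α}`. -/
noncomputable def greenTerm (k α : ℝ) (n : ℤ) (x : ℝ × ℝ) : ℂ :=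
  (1 / greenBeta k α n) *
    Complex.exp (Complex.I * ((((n : ℝ) + α) * x.1 : ℝ) : ℂ) +
      Complex.I * greenBeta k α n * ((|x.2| : ℝ) : ℂ))

/-- The quasi-periodic Green's function `G_{k,α}(x) = (i/(4π)) Σ_{n∈ℤ} greenTerm k α n x`. -/
noncomputable def greenFun (k α : ℝ) (x : ℝ × ℝ) : ℂ :=
  (Complex.I / (4 * (Real.pi : ℂ))) * ∑' n : ℤ, greenTerm k α n x

/-- The orthonormal trigonometric polynomials
`φ_j(x) = (4πρ)^{−1/2} exp(i((j₁+α)x₁ + (j₂π/ρ)x₂))`. -/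
noncomputable def phiFun (α ρ : ℝ) (j : ℤ × ℤ) (x : ℝ × ℝ) : ℂ :=
  (1 / (Real.sqrt (4 * Real.pi * ρ) : ℂ)) *
    Complex.exp (Complex.I *
      (((((j.1 : ℝ) + α) * x.1) + ((j.2 : ℝ) * Real.pi / ρ) * x.2 : ℝ) : ℂ))

/-- `λ_j = k² − (j₁+α)² − (j₂π/ρ)²`. -/
noncomputable def lamFun (k α ρ : ℝ) (j : ℤ × ℤ) : ℝ :=
  k ^ 2 - ((j.1 : ℝ) + α) ^ 2 - ((j.2 : ℝ) * Real.pi / ρ) ^ 2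

/-- The period cell `Ω_ρ = (−π,π) × (−ρ,ρ)`. -/
def OmegaRho (ρ : ℝ) : Set (ℝ × ℝ) := Set.Ioo (-Real.pi) Real.pi ×ˢ Set.Ioo (-ρ) ρ

/-- A countable series of integrable functions with summable `L¹` norms has an integrable sum. -/
theorem integrable_tsum_of_summable_integral_norm {X ι : Type*} [MeasurableSpace X] [Countable ι]
    {μ : Measure X} {F : ι → X → ℂ} (hF : ∀ i, Integrable (F i) μ)
    (hsum : Summable fun i => ∫ x, ‖F i x‖ ∂μ) :
    Integrable (fun x => ∑' i, F i x) μ := by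
  refine ⟨(AEMeasurable.tsum fun i => (hF i).1.aemeasurable).aestronglyMeasurable, ?_⟩
  calc ∫⁻ x, ‖∑' i, F i x‖ₑ ∂μ ≤ ∫⁻ x, ∑' i, ‖F i x‖ₑ ∂μ :=
        lintegral_mono fun x => enorm_tsum_le_tsum_enorm
    _ = ∑' i, ∫⁻ x, ‖F i x‖ₑ ∂μ := lintegral_tsum fun i => (hF i).1.enorm
    _ = ∑' i, ENNReal.ofReal (∫ x, ‖F i x‖ ∂μ) := by
        simp_rw [ofReal_integral_norm_eq_lintegral_enorm (hF _)]
    _ < ⊤ := hsum.tsum_ofReal_lt_top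

theorem integral_exp_int_mul_I (m : ℤ) :
    ∫ t in Set.Ioo (-Real.pi) Real.pi, Complex.exp (Complex.I * m * t) =
      if m = 0 then 2 * (Real.pi : ℂ) else 0 := by
  rw [← integral_Ioc_eq_integral_Ioo,
    ← intervalIntegral.integral_of_le (by linarith [Real.pi_pos])]
  split_ifs with h
  · subst h
    simp
    ring
  · rw [integral_exp_mul_complex (mul_ne_zero Complex.I_ne_zero (Int.cast_ne_zero.2 h)),
      div_eq_zero_iff]
    left
    rw [sub_eq_zero, Complex.exp_eq_exp_iff_exists_int]
    exact ⟨m, by push_cast; ring⟩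

theorem integral_exp_abs_sub {b c : ℂ} {ρ : ℝ} (hρ : 0 < ρ) (h₁ : b - c ≠ 0) (h₂ : b + c ≠ 0) :
    ∫ t in Set.Ioo (-ρ) ρ, Complex.exp (b * (|t| : ℝ) - c * t) =
      (Complex.exp (b * ρ - c * ρ) - 1) / (b - c) +
        (Complex.exp (b * ρ + c * ρ) - 1) / (b + c) := by
  have hint : ∀ u v : ℝ, IntervalIntegrable
      (fun t : ℝ => Complex.exp (b * (|t| : ℝ) - c * t)) volume u v :=
    fun u v => Continuous.intervalIntegrable (by fun_prop) u v
  have hpos : ∫ t in (0 : ℝ)..ρ, Complex.exp (b * (|t| : ℝ) - c * t) =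
      ∫ t in (0 : ℝ)..ρ, Complex.exp ((b - c) * t) := by
    refine intervalIntegral.integral_congr fun t ht => ?_
    rw [Set.uIcc_of_le hρ.le] at ht
    simp only [abs_of_nonneg ht.1, sub_mul]
  have hneg : ∫ t in (-ρ)..(0 : ℝ), Complex.exp (b * (|t| : ℝ) - c * t) =
      ∫ t in (-ρ)..(0 : ℝ), Complex.exp (-(b + c) * t) := by
    refine intervalIntegral.integral_congr fun t ht => ?_
    rw [Set.uIcc_of_le (by linarith)] at ht
    simp only [abs_of_nonpos ht.2]
    congr 1
    push_cast
    ring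
  rw [← integral_Ioc_eq_integral_Ioo, ← intervalIntegral.integral_of_le (by linarith),
    ← intervalIntegral.integral_add_adjacent_intervals (hint (-ρ) 0) (hint 0 ρ), hpos, hneg,
    integral_exp_mul_complex h₁, integral_exp_mul_complex (neg_ne_zero.2 h₂), add_comm]
  have e₁ : (b - c) * (ρ : ℂ) = b * ρ - c * ρ := by ring
  have e₂ : -(b + c) * ((-ρ : ℝ) : ℂ) = b * ρ + c * ρ := by push_cast; ring
  rw [e₁, e₂]
  simp only [Complex.ofReal_zero, mul_zero, Complex.exp_zero]
  rw [div_neg, ← neg_div, neg_sub]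

theorem setIntegral_exp_neg_mul_abs_le {γ : ℝ} (hγ : 0 < γ) (s : Set ℝ) :
    ∫ t in s, Real.exp (-γ * |t|) ≤ 2 / γ := by
  have heq : ∫ t : ℝ, Real.exp (-γ * |t|) = 2 / γ := by
    rw [integral_comp_abs (f := fun t => Real.exp (-γ * t)), integral_exp_mul_Ioi (by linarith)]
    simp
    ring
  have hint : Integrable fun t : ℝ => Real.exp (-γ * |t|) :=
    Integrable.of_integral_ne_zero (by rw [heq]; positivity)
  rw [← heq]
  exact setIntegral_le_integral hint (Filter.Eventually.of_forall fun t => (Real.exp_pos _).le)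

theorem greenBeta_sq (k α : ℝ) (n : ℤ) :
    greenBeta k α n ^ 2 = ((k ^ 2 - ((n : ℝ) + α) ^ 2 : ℝ) : ℂ) := by
  unfold greenBeta
  split_ifs with h
  · rw [mul_pow, Complex.I_sq, ← Complex.ofReal_pow, Real.sq_sqrt (by linarith)]
    push_cast
    ring
  · rw [← Complex.ofReal_pow, Real.sq_sqrt (by linarith)]

theorem greenBeta_ne_zero {k α : ℝ} {n : ℤ} (h : k ^ 2 ≠ ((n : ℝ) + α) ^ 2) :
    greenBeta k α n ≠ 0 := by
  intro h0
  have := greenBeta_sq k α n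
  rw [h0, zero_pow two_ne_zero, eq_comm, Complex.ofReal_eq_zero, sub_eq_zero] at this
  exact h this

/-- Only finitely many `n` satisfy `(n + α)² ≤ 2k²`. -/
theorem eventually_two_mul_sq_lt (k α : ℝ) :
    ∀ᶠ n : ℤ in Filter.cofinite, 2 * k ^ 2 < ((n : ℝ) + α) ^ 2 := by
  have h : Filter.Tendsto (fun n : ℤ => 1 / |(n : ℝ) + α| ^ (2 : ℝ)) Filter.cofinite (nhds 0) :=
    ((Real.summable_one_div_int_add_rpow α 2).2 one_lt_two).tendsto_cofinite_zero
  have hfin : ∀ᶠ n : ℤ in Filter.cofinite, (n : ℝ) + α ≠ 0 := by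
    have : {n : ℤ | ¬ ((n : ℝ) + α ≠ 0)}.Subsingleton := by
      intro m hm n hn
      simp only [Set.mem_ofPred_eq, not_not] at hm hn
      exact_mod_cast (by linarith : (m : ℝ) = n)
    exact this.finite
  have hlt := h.eventually (gt_mem_nhds (show (0 : ℝ) < 1 / (2 * k ^ 2 + 1) by positivity))
  filter_upwards [hlt, hfin] with n hn hn0
  have hpos : 0 < ((n : ℝ) + α) ^ 2 := by positivity
  rw [Real.rpow_two, sq_abs] at hn
  have := (one_div_lt_one_div hpos (by positivity)).1 hn
  linarith

/-- Each term of the integrand is a function of `x₁` times a function of `x₂`. -/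
theorem greenTerm_mul_conj_phiFun (k α ρ : ℝ) (j : ℤ × ℤ) (n : ℤ) (x : ℝ × ℝ) :
    Complex.I / (4 * (Real.pi : ℂ)) * greenTerm k α n x * (starRingEnd ℂ) (phiFun α ρ j x) =
      Complex.I / (4 * (Real.pi : ℂ)) / greenBeta k α n / (Real.sqrt (4 * Real.pi * ρ) : ℂ) *
        (Complex.exp (Complex.I * ((n - j.1 : ℤ) : ℂ) * x.1) *
          Complex.exp (Complex.I * greenBeta k α n * (|x.2| : ℝ) -
            Complex.I * ((j.2 : ℝ) * Real.pi / ρ : ℝ) * x.2)) := by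
  unfold greenTerm phiFun
  rw [map_mul, ← Complex.exp_conj, map_mul, Complex.conj_I, Complex.conj_ofReal, map_div₀, map_one,
    Complex.conj_ofReal, ← Complex.exp_add]
  have hexp : ∀ a b u v : ℂ, a + b = u →
      Complex.I / (4 * (Real.pi : ℂ)) * (1 / greenBeta k α n * Complex.exp a) *
        (1 / v * Complex.exp b) =
      Complex.I / (4 * (Real.pi : ℂ)) / greenBeta k α n / v * Complex.exp u := by
    rintro a b u v rfl
    rw [Complex.exp_add]
    ring
  apply hexp
  push_cast
  ring

theorem norm_exp_greenBeta {k α : ℝ} {n : ℤ} (h : k ^ 2 < ((n : ℝ) + α) ^ 2) (c t : ℝ) :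
    ‖Complex.exp (Complex.I * greenBeta k α n * (|t| : ℝ) - Complex.I * c * t)‖ =
      Real.exp (-Real.sqrt (((n : ℝ) + α) ^ 2 - k ^ 2) * |t|) := by
  rw [Complex.norm_exp, greenBeta, if_pos h]
  simp

theorem norm_greenBeta {k α : ℝ} {n : ℤ} (h : k ^ 2 < ((n : ℝ) + α) ^ 2) :
    ‖greenBeta k α n‖ = Real.sqrt (((n : ℝ) + α) ^ 2 - k ^ 2) := by
  rw [greenBeta, if_pos h]
  simp [abs_of_nonneg (Real.sqrt_nonneg _)]

theorem setIntegral_OmegaRho_mul {𝕜 : Type*} [RCLike 𝕜] (ρ : ℝ) (f g : ℝ → 𝕜) :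
    ∫ x in OmegaRho ρ, f x.1 * g x.2 =
      (∫ t in Set.Ioo (-Real.pi) Real.pi, f t) * ∫ t in Set.Ioo (-ρ) ρ, g t :=
  setIntegral_prod_mul f g _ _

theorem integrableOn_OmegaRho_of_continuous {F : ℝ × ℝ → ℂ} (hF : Continuous F) (ρ : ℝ) :
    IntegrableOn F (OmegaRho ρ) :=
  (hF.continuousOn.integrableOn_compact (isCompact_Icc.prod isCompact_Icc)).mono_set
    (Set.prod_mono Set.Ioo_subset_Icc_self Set.Ioo_subset_Icc_self)

theorem integrableOn_green_term (k α ρ : ℝ) (j : ℤ × ℤ) (n : ℤ) :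
    IntegrableOn (fun x => Complex.I / (4 * (Real.pi : ℂ)) * greenTerm k α n x *
      (starRingEnd ℂ) (phiFun α ρ j x)) (OmegaRho ρ) := by
  simp_rw [greenTerm_mul_conj_phiFun]
  exact integrableOn_OmegaRho_of_continuous (by fun_prop) ρ

theorem integral_norm_green_term_le {k α : ℝ} {n : ℤ} (h : 2 * k ^ 2 < ((n : ℝ) + α) ^ 2)
    {ρ : ℝ} (hρ : 0 < ρ) (j : ℤ × ℤ) :
    ∫ x in OmegaRho ρ, ‖Complex.I / (4 * (Real.pi : ℂ)) * greenTerm k α n x *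
      (starRingEnd ℂ) (phiFun α ρ j x)‖ ≤
      2 / Real.sqrt (4 * Real.pi * ρ) * (1 / |(n : ℝ) + α| ^ (2 : ℝ)) := by
  have hlt : k ^ 2 < ((n : ℝ) + α) ^ 2 := by nlinarith [sq_nonneg k]
  set γ := Real.sqrt (((n : ℝ) + α) ^ 2 - k ^ 2) with hγ
  have hγpos : 0 < γ := Real.sqrt_pos.2 (by linarith)
  have hγsq : γ ^ 2 = ((n : ℝ) + α) ^ 2 - k ^ 2 := Real.sq_sqrt (by linarith)
  have hexp : ∀ t : ℝ, ‖Complex.exp (Complex.I * ((n - j.1 : ℤ) : ℂ) * t)‖ = 1 := by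
    intro t
    rw [Complex.norm_exp]
    simp
  have hS : 0 < Real.sqrt (4 * Real.pi * ρ) := Real.sqrt_pos.2 (by positivity)
  have hpi := Real.pi_pos
  simp_rw [greenTerm_mul_conj_phiFun, norm_mul (_ / _ / _ / _), norm_mul (Complex.exp _), hexp,
    norm_exp_greenBeta hlt]
  rw [integral_const_mul,
    setIntegral_OmegaRho_mul ρ (fun _ => (1 : ℝ)) (fun t => Real.exp (-γ * |t|))]
  have hvol : ∫ _ in Set.Ioo (-Real.pi) Real.pi, (1 : ℝ) = 2 * Real.pi := by
    simp [hpi.le]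
    ring
  rw [hvol]
  simp only [norm_div, norm_mul, Complex.norm_I, norm_greenBeta hlt, ← hγ, Complex.norm_real,
    Real.norm_of_nonneg hS.le, Real.norm_of_nonneg hpi.le, Complex.norm_ofNat]
  have hsq : 0 < ((n : ℝ) + α) ^ 2 := by nlinarith [sq_nonneg k]
  calc 1 / (4 * Real.pi) / γ / Real.sqrt (4 * Real.pi * ρ) *
        (2 * Real.pi * ∫ t in Set.Ioo (-ρ) ρ, Real.exp (-γ * |t|))
      ≤ 1 / (4 * Real.pi) / γ / Real.sqrt (4 * Real.pi * ρ) * (2 * Real.pi * (2 / γ)) := by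
        gcongr
        exact setIntegral_exp_neg_mul_abs_le hγpos _
    _ = 1 / Real.sqrt (4 * Real.pi * ρ) * (1 / γ ^ 2) := by field_simp; ring
    _ ≤ 1 / Real.sqrt (4 * Real.pi * ρ) * (2 / ((n : ℝ) + α) ^ 2) := by
        gcongr ?_ * ?_
        rw [div_le_div_iff₀ (by positivity) hsq, hγsq]
        linarith
    _ = _ := by rw [Real.rpow_two, sq_abs]; ring

theorem summable_integral_norm_green_term (k α : ℝ) {ρ : ℝ} (hρ : 0 < ρ) (j : ℤ × ℤ) :
    Summable fun n : ℤ => ∫ x in OmegaRho ρ, ‖Complex.I / (4 * (Real.pi : ℂ)) *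
      greenTerm k α n x * (starRingEnd ℂ) (phiFun α ρ j x)‖ := by
  refine Summable.of_norm_bounded_eventually
    (((Real.summable_one_div_int_add_rpow α 2).2 one_lt_two).mul_left
      (2 / Real.sqrt (4 * Real.pi * ρ))) ?_
  filter_upwards [eventually_two_mul_sq_lt k α] with n hn
  rw [Real.norm_of_nonneg (integral_nonneg fun x => norm_nonneg _)]
  exact integral_norm_green_term_le hn hρ j

theorem integral_green_term {k α : ℝ} (hres : ∀ n : ℤ, k ^ 2 ≠ ((n : ℝ) + α) ^ 2)
    {ρ : ℝ} (hρ : 0 < ρ) {j : ℤ × ℤ} (hj : lamFun k α ρ j ≠ 0) (n : ℤ) :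
    ∫ x in OmegaRho ρ, Complex.I / (4 * (Real.pi : ℂ)) * greenTerm k α n x *
      (starRingEnd ℂ) (phiFun α ρ j x) =
      if n = j.1 then ((Real.cos ((j.2 : ℝ) * Real.pi) : ℂ) *
          Complex.exp (Complex.I * greenBeta k α j.1 * (ρ : ℂ)) - 1) /
        ((Real.sqrt (4 * Real.pi * ρ) : ℂ) * (lamFun k α ρ j : ℂ)) else 0 := by
  simp_rw [greenTerm_mul_conj_phiFun]
  rw [integral_const_mul, setIntegral_OmegaRho_mul ρ
    (fun t => Complex.exp (Complex.I * ((n - j.1 : ℤ) : ℂ) * t))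
    (fun t => Complex.exp (Complex.I * greenBeta k α n * (|t| : ℝ) -
      Complex.I * ((j.2 : ℝ) * Real.pi / ρ : ℝ) * t)), integral_exp_int_mul_I]
  simp only [sub_eq_zero]
  split_ifs with hn
  swap
  · simp
  subst hn
  set β := greenBeta k α j.1 with hβ
  set c : ℝ := (j.2 : ℝ) * Real.pi / ρ with hc
  have hβ0 : β ≠ 0 := greenBeta_ne_zero (hres _)
  have hlam : (lamFun k α ρ j : ℂ) = (β - c) * (β + c) := by
    have := greenBeta_sq k α j.1
    rw [lamFun, ← hc, Complex.ofReal_sub, ← this]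
    push_cast
    ring
  have hlam0 : (β - c) * (β + c) ≠ 0 := hlam ▸ Complex.ofReal_ne_zero.2 hj
  obtain ⟨hm, hp⟩ := mul_ne_zero_iff.1 hlam0
  have hm' : Complex.I * β - Complex.I * c ≠ 0 := by
    rw [← mul_sub]
    exact mul_ne_zero Complex.I_ne_zero hm
  have hp' : Complex.I * β + Complex.I * c ≠ 0 := by
    rw [← mul_add]
    exact mul_ne_zero Complex.I_ne_zero hp
  have hcρ : Complex.I * c * ρ = ((j.2 : ℝ) * Real.pi : ℝ) * Complex.I := by
    have : c * ρ = (j.2 : ℝ) * Real.pi := by rw [hc]; field_simp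
    rw [← this]
    push_cast
    ring
  have hexp : Complex.exp (Complex.I * c * ρ) = (Real.cos ((j.2 : ℝ) * Real.pi) : ℂ) := by
    rw [hcρ, Complex.exp_mul_I, ← Complex.ofReal_cos, ← Complex.ofReal_sin, Real.sin_int_mul_pi]
    simp
  have hexp' : Complex.exp (-(Complex.I * c * ρ)) = (Real.cos ((j.2 : ℝ) * Real.pi) : ℂ) := by
    rw [hcρ, ← neg_mul, Complex.exp_mul_I, ← Complex.ofReal_neg, ← Complex.ofReal_cos,
      ← Complex.ofReal_sin, Real.cos_neg, Real.sin_neg, Real.sin_int_mul_pi]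
    simp
  rw [integral_exp_abs_sub hρ hm' hp', sub_eq_add_neg (Complex.I * β * ρ), Complex.exp_add,
    Complex.exp_add, hexp, hexp', hlam]
  have hS : (Real.sqrt (4 * Real.pi * ρ) : ℂ) ≠ 0 :=
    Complex.ofReal_ne_zero.2 (Real.sqrt_pos.2 (by positivity)).ne'
  have hpi : (Real.pi : ℂ) ≠ 0 := Complex.ofReal_ne_zero.2 Real.pi_ne_zero
  rw [← mul_sub, ← mul_add]
  field_simp
  ring

/-- **Theorem 3.2, case `λ_j ≠ 0`.** For `λ_j ≠ 0`, the function
`x ↦ G_{k,α}(x) conj(φ_j(x))` is integrable on `Ω_ρ` and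
`∫_{Ω_ρ} G_{k,α} conj(φ_j) = (cos(j₂π) e^{iβ_{j₁}ρ} − 1)/(√(4πρ) λ_j)`. -/
theorem fourierCoeff_green_ne_zero
    (k α : ℝ) (hk : 0 < k)
    (hres : ∀ n : ℤ, k ^ 2 ≠ ((n : ℝ) + α) ^ 2)
    (ρ : ℝ) (hρ : 0 < ρ) (j : ℤ × ℤ) (hj : lamFun k α ρ j ≠ 0) :
    IntegrableOn (fun x => greenFun k α x * (starRingEnd ℂ) (phiFun α ρ j x)) (OmegaRho ρ) ∧
    ∫ x in OmegaRho ρ, greenFun k α x * (starRingEnd ℂ) (phiFun α ρ j x) =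
      ((Real.cos ((j.2 : ℝ) * Real.pi) : ℂ) *
          Complex.exp (Complex.I * greenBeta k α j.1 * (ρ : ℂ)) - 1) /
        ((Real.sqrt (4 * Real.pi * ρ) : ℂ) * (lamFun k α ρ j : ℂ)) := by
  have hgreen : (fun x => greenFun k α x * (starRingEnd ℂ) (phiFun α ρ j x)) = fun x =>
      ∑' n : ℤ, Complex.I / (4 * (Real.pi : ℂ)) * greenTerm k α n x *
        (starRingEnd ℂ) (phiFun α ρ j x) := by
    funext x
    rw [greenFun, tsum_mul_right, tsum_mul_left]
  have hint := integrableOn_green_term k α ρ j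
  have hsum := summable_integral_norm_green_term k α hρ j
  rw [hgreen]
  refine ⟨integrable_tsum_of_summable_integral_norm hint hsum, ?_⟩
  rw [← integral_tsum_of_summable_integral_norm hint hsum]
  simp_rw [integral_green_term hres hρ hj]
  exact tsum_ite_eq j.1 _
end

section
/- Let D : ℝ² → ℂ be the continuous function D(x) := (i/(4π)) Σ_{n∈ℤ} [(1/β_n) exp(i α_n x₁ + i β_n |x₂|) − (1/γ_n) exp(i α_n x₁ + i γ_n |x₂|)], which equals the difference G_{k,α} − G_{i,α} of the quasi-periodic Green's functions with wave numbers k and i. Then there exist r > 0, a function A : ℝ² → ℂ that is real-analytic on the open ball {|x| < r}, and a function b : ℝ → ℂ that is analytic on a neighborhood of 0 such that D(x) = A(x) + |x|² ln(|x|) · b(|x|²) for all x with 0 < |x| < r. -/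
open MeasureTheory

/-- `γ_n = i(1 + α_n²)^{1/2}`, the value of `β_n` for wave number `i`. -/
noncomputable def greenGamma (α : ℝ) (n : ℤ) : ℂ :=
  Complex.I * (Real.sqrt (1 + ((n : ℝ) + α) ^ 2) : ℂ)

/-- The `n`-th term of the series for `G_{i,α}`. -/
noncomputable def greenTermI (α : ℝ) (n : ℤ) (x : ℝ × ℝ) : ℂ :=
  (1 / greenGamma α n) *
    Complex.exp (Complex.I * ((((n : ℝ) + α) * x.1 : ℝ) : ℂ) +
      Complex.I * greenGamma α n * ((|x.2| : ℝ) : ℂ))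

/-- The difference `D = G_{k,α} − G_{i,α}` of the quasi-periodic Green's functions with wave
numbers `k` and `i`, given by the absolutely and uniformly convergent series. -/
noncomputable def greenDiff (k α : ℝ) (x : ℝ × ℝ) : ℂ :=
  (Complex.I / (4 * (Real.pi : ℂ))) *
    ∑' n : ℤ, (greenTerm k α n x - greenTermI α n x)

/-- The Euclidean norm on `ℝ²`. -/
noncomputable def euclNorm (x : ℝ × ℝ) : ℝ := Real.sqrt (x.1 ^ 2 + x.2 ^ 2)

section

open Set Filter Topology

theorem analyticOnNhd_integral_exp_clm {Ω E : Type*} [MeasurableSpace Ω] {μ : Measure Ω}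
    [NormedAddCommGroup E] [NormedSpace ℝ E]
    {c : Ω → ℂ} {φ : Ω → E →L[ℝ] ℂ} (hc : AEStronglyMeasurable c μ)
    (hφ : AEStronglyMeasurable φ μ)
    (hint : Integrable (fun ω => ‖c ω‖ * Real.exp ‖φ ω‖) μ) :
    AnalyticOnNhd ℝ (fun w => ∫ ω, c ω * Complex.exp (φ ω w) ∂μ) (Metric.ball 0 1) := by
  set q : (n : ℕ) → Ω → E [×n]→L[ℝ] ℂ := fun n ω =>
    (c ω * (n.factorial : ℂ)⁻¹) • (ContinuousMultilinearMap.mkPiAlgebraFin ℝ n ℂ).compContinuousLinearMap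
      (fun _ => φ ω) with hq
  have hqn : ∀ n ω, ‖q n ω‖ ≤ ‖c ω‖ * (‖φ ω‖ ^ n / n.factorial) := by
    intro n ω
    have h1 : ‖(ContinuousMultilinearMap.mkPiAlgebraFin ℝ n ℂ).compContinuousLinearMap
      (fun _ => φ ω)‖ ≤ ‖φ ω‖ ^ n := by
      refine (ContinuousMultilinearMap.norm_compContinuousLinearMap_le _ _).trans ?_
      simp
    simp only [hq]
    rw [norm_smul, norm_mul, norm_inv, Complex.norm_natCast]
    calc _ ≤ ‖c ω‖ * (n.factorial : ℝ)⁻¹ * ‖φ ω‖ ^ n := by gcongr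
      _ = _ := by ring
  have hqm : ∀ n, AEStronglyMeasurable (q n) μ := by
    intro n
    refine (hc.mul aestronglyMeasurable_const).smul ?_
    have hcont : Continuous (fun ψ : E →L[ℝ] ℂ =>
        (ContinuousMultilinearMap.mkPiAlgebraFin ℝ n ℂ).compContinuousLinearMap (fun _ => ψ)) := by
      have h2 := (ContinuousMultilinearMap.compContinuousLinearMapContinuousMultilinear ℝ
        (fun _ : Fin n => E) (fun _ : Fin n => ℂ) ℂ).cont
      have h3 : Continuous (fun ψ : E →L[ℝ] ℂ => (fun _ : Fin n => ψ)) := by fun_prop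
      exact (h2.comp h3).clm_apply continuous_const
    exact hcont.comp_aestronglyMeasurable hφ
  have hle : ∀ n ω, ‖q n ω‖ ≤ ‖c ω‖ * Real.exp ‖φ ω‖ := fun n ω =>
    (hqn n ω).trans (by gcongr; exact Real.pow_div_factorial_le_exp _ (norm_nonneg _) n)
  have hqi : ∀ n, Integrable (q n) μ := fun n =>
    hint.mono' (hqm n) (Eventually.of_forall (hle n))
  have key : HasFPowerSeriesOnBall (fun w => ∫ ω, c ω * Complex.exp (φ ω w) ∂μ)
      (fun n => ∫ ω, q n ω ∂μ) 0 1 := by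
    refine ⟨?_, one_pos, ?_⟩
    · refine FormalMultilinearSeries.le_radius_of_bound _
        (∫ ω, ‖c ω‖ * Real.exp ‖φ ω‖ ∂μ) (r := 1) fun n => ?_
      simp only [NNReal.coe_one, one_pow, mul_one]
      exact norm_integral_le_of_norm_le hint (Eventually.of_forall (hle n))
    · intro y hy
      have hy1 : ‖y‖ ≤ 1 := by
        rw [Metric.mem_eball, edist_zero_right] at hy
        rw [← ENNReal.ofReal_le_ofReal_iff zero_le_one, ofReal_norm]
        simpa using hy.le
      have happ : ∀ n, (∫ ω, q n ω ∂μ) (fun _ => y)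
          = ∫ ω, c ω * (φ ω y ^ n / n.factorial) ∂μ := by
        intro n
        have := (ContinuousMultilinearMap.apply ℝ (fun _ : Fin n => E) ℂ (fun _ => y)).integral_comp_comm (hqi n)
        simp only [ContinuousMultilinearMap.apply_apply] at this
        rw [← this]
        congr 1; ext ω
        simp [hq]; ring
      simp only [happ, zero_add]
      have hb : ∀ n ω, ‖c ω * (φ ω y ^ n / n.factorial)‖ ≤ ‖c ω‖ * (‖φ ω‖ ^ n / n.factorial) := by
        intro n ω
        rw [norm_mul, norm_div, norm_pow, Complex.norm_natCast]
        gcongr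
        exact ((φ ω).le_opNorm y).trans (mul_le_of_le_one_right (norm_nonneg _) hy1)
      have hφm : AEStronglyMeasurable (fun ω => φ ω y) μ :=
        (ContinuousLinearMap.apply ℝ ℂ y).continuous.comp_aestronglyMeasurable hφ
      refine hasSum_integral_of_dominated_convergence
        (fun n ω => ‖c ω‖ * (‖φ ω‖ ^ n / n.factorial)) (fun n => ?_)
        (fun n => Eventually.of_forall (hb n)) (Eventually.of_forall fun ω => ?_) ?_
        (Eventually.of_forall fun ω => ?_)
      · exact hc.mul ((hφm.pow n).mul aestronglyMeasurable_const)
      · exact (Real.summable_pow_div_factorial _).mul_left _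
      · refine hint.congr (Eventually.of_forall fun ω => ?_)
        simp only
        rw [tsum_mul_left, Real.exp_eq_exp_ℝ, NormedSpace.exp_eq_tsum_div]
      · rw [Complex.exp_eq_exp_ℂ, NormedSpace.exp_eq_tsum_div]
        exact (NormedSpace.expSeries_div_summable (𝔸 := ℂ) (φ ω y)).hasSum.mul_left _
  have h := key.analyticOnNhd
  rwa [← ENNReal.ofReal_one, Metric.eball_ofReal] at h

/-- The exponential of a quadratic polynomial in the coordinates, without mixed terms
and without a linear term in `x₂`. -/
noncomputable def expKernel (P Q S : ℂ) (x : ℝ × ℝ) : ℂ :=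
  Complex.exp (P * x.1 + Q * (x.1 ^ 2 : ℝ) + S * (x.2 ^ 2 : ℝ))

theorem abs_lt_of_euclNorm_lt {x : ℝ × ℝ} (hx : euclNorm x < 1) : |x.1| < 1 ∧ |x.2| < 1 := by
  rw [euclNorm, Real.sqrt_lt' one_pos] at hx
  constructor <;> rw [abs_lt] <;> constructor <;> nlinarith [sq_nonneg x.1, sq_nonneg x.2]

theorem norm_expKernel_le (P Q S : ℂ) {x : ℝ × ℝ} (hx : euclNorm x < 1) :
    ‖expKernel P Q S x‖ ≤ Real.exp (‖P‖ + ‖Q‖ + ‖S‖) := by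
  obtain ⟨h1, h2⟩ := abs_lt_of_euclNorm_lt hx
  refine (Complex.norm_exp_le_exp_norm _).trans (Real.exp_le_exp.mpr ?_)
  refine (norm_add₃_le).trans ?_
  simp only [norm_mul, Complex.norm_real, Real.norm_eq_abs, abs_pow]
  have h3 : |x.1| ^ 2 ≤ 1 := pow_le_one₀ (abs_nonneg _) h1.le
  have h4 : |x.2| ^ 2 ≤ 1 := pow_le_one₀ (abs_nonneg _) h2.le
  gcongr ?_ + ?_ + ?_
  · exact mul_le_of_le_one_right (norm_nonneg _) h1.le
  · exact mul_le_of_le_one_right (norm_nonneg _) h3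
  · exact mul_le_of_le_one_right (norm_nonneg _) h4

theorem analyticOnNhd_integral_expKernel {Ω : Type*} [MeasurableSpace Ω] {μ : Measure Ω}
    {c P Q S : Ω → ℂ} (hc : AEStronglyMeasurable c μ) (hP : AEStronglyMeasurable P μ)
    (hQ : AEStronglyMeasurable Q μ) (hS : AEStronglyMeasurable S μ)
    (hint : Integrable (fun ω => ‖c ω‖ * Real.exp (‖P ω‖ + ‖Q ω‖ + ‖S ω‖)) μ) :
    AnalyticOnNhd ℝ (fun x : ℝ × ℝ => ∫ ω, c ω * expKernel (P ω) (Q ω) (S ω) x ∂μ)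
      {x | euclNorm x < 1} := by
  let L₁ : ℝ × ℝ × ℝ →L[ℝ] ℂ := Complex.ofRealCLM.comp (ContinuousLinearMap.fst ℝ ℝ (ℝ × ℝ))
  let L₂ : ℝ × ℝ × ℝ →L[ℝ] ℂ := Complex.ofRealCLM.comp
    ((ContinuousLinearMap.fst ℝ ℝ ℝ).comp (ContinuousLinearMap.snd ℝ ℝ (ℝ × ℝ)))
  let L₃ : ℝ × ℝ × ℝ →L[ℝ] ℂ := Complex.ofRealCLM.comp
    ((ContinuousLinearMap.snd ℝ ℝ ℝ).comp (ContinuousLinearMap.snd ℝ ℝ (ℝ × ℝ)))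
  have hL₁ : ‖L₁‖ ≤ 1 := ContinuousLinearMap.opNorm_le_bound _ zero_le_one fun w => by
    simpa [L₁] using norm_fst_le w
  have hL₂ : ‖L₂‖ ≤ 1 := ContinuousLinearMap.opNorm_le_bound _ zero_le_one fun w => by
    simpa [L₂] using (norm_fst_le w.2).trans (norm_snd_le w)
  have hL₃ : ‖L₃‖ ≤ 1 := ContinuousLinearMap.opNorm_le_bound _ zero_le_one fun w => by
    simpa [L₃] using (norm_snd_le w.2).trans (norm_snd_le w)
  have hφ : AEStronglyMeasurable (fun ω => P ω • L₁ + Q ω • L₂ + S ω • L₃) μ :=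
    ((hP.smul aestronglyMeasurable_const).add (hQ.smul aestronglyMeasurable_const)).add
      (hS.smul aestronglyMeasurable_const)
  have hφn : ∀ ω, ‖P ω • L₁ + Q ω • L₂ + S ω • L₃‖ ≤ ‖P ω‖ + ‖Q ω‖ + ‖S ω‖ := fun ω => by
    refine norm_add₃_le.trans ?_
    rw [norm_smul, norm_smul, norm_smul]
    gcongr
    · exact mul_le_of_le_one_right (norm_nonneg _) hL₁
    · exact mul_le_of_le_one_right (norm_nonneg _) hL₂
    · exact mul_le_of_le_one_right (norm_nonneg _) hL₃
  have hmain := analyticOnNhd_integral_exp_clm hc hφ (hint.mono'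
    (hc.norm.mul (Real.continuous_exp.comp_aestronglyMeasurable hφ.norm))
    (Eventually.of_forall fun ω => by
      rw [Real.norm_of_nonneg (by positivity)]
      exact mul_le_mul_of_nonneg_left (Real.exp_le_exp.mpr (hφn ω)) (norm_nonneg _)))
  have hpoly : AnalyticOnNhd ℝ (fun x : ℝ × ℝ => (x.1, x.1 ^ 2, x.2 ^ 2)) {x | euclNorm x < 1} :=
    fun x _ => analyticAt_fst.prod ((analyticAt_fst.pow 2).prod (analyticAt_snd.pow 2))
  refine (hmain.comp hpoly fun x hx => ?_).congr' ?_
  · obtain ⟨h1, h2⟩ := abs_lt_of_euclNorm_lt hx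
    have h3 : |x.1| ^ 2 < 1 := pow_lt_one₀ (abs_nonneg _) h1 two_ne_zero
    have h4 : |x.2| ^ 2 < 1 := pow_lt_one₀ (abs_nonneg _) h2 two_ne_zero
    simp [Prod.norm_def, h1, h2]
  · refine Eventually.of_forall fun x => ?_
    simp [expKernel, L₁, L₂, L₃]

theorem exists_analyticOnNhd_tsum_integral_expKernel {μ : Measure ℝ} [SFinite μ]
    {c P Q S : ℤ → ℝ → ℂ} (hc : ∀ n, Measurable (c n)) (hP : ∀ n, Measurable (P n))
    (hQ : ∀ n, Measurable (Q n)) (hS : ∀ n, Measurable (S n)) {f : ℤ → ℝ} {h : ℝ → ℝ}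
    (hf : Summable f) (hhm : Measurable h) (hh : Integrable h μ)
    (hb : ∀ n, ∀ᵐ t ∂μ, ‖c n t‖ * Real.exp (‖P n t‖ + ‖Q n t‖ + ‖S n t‖) ≤ f n * h t) :
    ∃ F : ℝ × ℝ → ℂ, AnalyticOnNhd ℝ F {x | euclNorm x < 1} ∧ ∀ x, euclNorm x < 1 →
      HasSum (fun n => ∫ t, c n t * expKernel (P n t) (Q n t) (S n t) x ∂μ) (F x) ∧
      F x = ∫ t, ∑' n, c n t * expKernel (P n t) (Q n t) (S n t) x ∂μ := by
  have hfi : Integrable f (Measure.count : Measure ℤ) := integrable_count_iff.mpr hf.norm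
  have hmeas : ∀ {g : ℤ → ℝ → ℂ}, (∀ n, Measurable (g n)) →
      Measurable (fun p : ℤ × ℝ => g p.1 p.2) := fun hg => measurable_from_prod_countable_right hg
  have hc' := hmeas hc
  have hP' := hmeas hP
  have hQ' := hmeas hQ
  have hS' := hmeas hS
  have hint : Integrable (fun p : ℤ × ℝ =>
      ‖c p.1 p.2‖ * Real.exp (‖P p.1 p.2‖ + ‖Q p.1 p.2‖ + ‖S p.1 p.2‖))
      (Measure.count.prod μ) := by
    refine (hfi.mul_prod hh).mono' (Measurable.aestronglyMeasurable (by fun_prop)) ?_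
    rw [Measure.ae_prod_iff_ae_ae (measurableSet_le (by fun_prop) (by fun_prop))]
    refine Eventually.of_forall fun n => (hb n).mono fun t ht => ?_
    rwa [Real.norm_of_nonneg (by positivity)]
  refine ⟨_, analyticOnNhd_integral_expKernel hc'.aestronglyMeasurable hP'.aestronglyMeasurable
    hQ'.aestronglyMeasurable hS'.aestronglyMeasurable hint, fun x hx => ?_⟩
  have hKb : ∀ c P Q S : ℂ, ‖c * expKernel P Q S x‖ ≤ ‖c‖ * Real.exp (‖P‖ + ‖Q‖ + ‖S‖) :=
    fun c P Q S => by
      rw [norm_mul]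
      exact mul_le_mul_of_nonneg_left (norm_expKernel_le P Q S hx) (norm_nonneg _)
  have hKi : ∀ n, Integrable (fun t => c n t * expKernel (P n t) (Q n t) (S n t) x) μ := fun n => by
    refine (hh.const_mul (f n)).mono' ?_ ((hb n).mono fun t ht => (hKb _ _ _ _).trans ht)
    have := hc n
    have := hP n
    have := hQ n
    have := hS n
    unfold expKernel
    exact Measurable.aestronglyMeasurable (by fun_prop)
  have hKp : Integrable (fun p : ℤ × ℝ =>
      c p.1 p.2 * expKernel (P p.1 p.2) (Q p.1 p.2) (S p.1 p.2) x) (Measure.count.prod μ) := by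
    refine hint.mono' ?_ (Eventually.of_forall fun p => hKb _ _ _ _)
    unfold expKernel
    exact Measurable.aestronglyMeasurable (by fun_prop)
  have hsum := hasSum_integral_of_summable_integral_norm hKi
    (Summable.of_nonneg_of_le (fun n => by positivity) (fun n => by
      rw [← integral_const_mul]
      exact integral_mono_ae (hKi n).norm (hh.const_mul _)
        ((hb n).mono fun t ht => (hKb _ _ _ _).trans ht)) (hf.mul_right (∫ t, h t ∂μ)))
  have heq : ∫ p : ℤ × ℝ, c p.1 p.2 * expKernel (P p.1 p.2) (Q p.1 p.2) (S p.1 p.2) x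
      ∂(Measure.count.prod μ) = ∫ t, ∑' n, c n t * expKernel (P n t) (Q n t) (S n t) x ∂μ := by
    rw [integral_prod _ hKp, integral_countable hKp.integral_prod_left, ← hsum.tsum_eq]
    simp [Measure.real]
  exact ⟨by rw [heq]; exact hsum, heq⟩

theorem exists_gaussian_primitive :
    ∃ Φ : ℂ → ℂ, Φ 0 = 0 ∧ ∀ z, HasDerivAt Φ (Complex.exp (-z ^ 2)) z := by
  have hd : Differentiable ℂ (fun z : ℂ => Complex.exp (-z ^ 2)) := by fun_prop
  obtain ⟨Φ, h0, h1⟩ := hd.isExactOn_univ.with_val_at 0 0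
  exact ⟨Φ, h0, fun z => h1 z (mem_univ z)⟩

/-- The primitive of `exp (-z ^ 2)` on `ℂ` that vanishes at the origin. -/
noncomputable def gaussPrim : ℂ → ℂ := Classical.choose exists_gaussian_primitive

theorem gaussPrim_zero : gaussPrim 0 = 0 := (Classical.choose_spec exists_gaussian_primitive).1

theorem hasDerivAt_gaussPrim (z : ℂ) : HasDerivAt gaussPrim (Complex.exp (-z ^ 2)) z :=
  (Classical.choose_spec exists_gaussian_primitive).2 z

theorem gaussPrim_ofReal (x : ℝ) :
    gaussPrim x = ((∫ t in (0 : ℝ)..x, Real.exp (-1 * t ^ 2) : ℝ) : ℂ) := by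
  have h := intervalIntegral.integral_eq_sub_of_hasDerivAt (a := (0 : ℝ)) (b := x)
    (f := fun t : ℝ => gaussPrim t) (f' := fun t : ℝ => Complex.exp (-(t : ℂ) ^ 2))
    (fun t _ => (hasDerivAt_gaussPrim t).comp_ofReal)
    (Continuous.intervalIntegrable (by fun_prop) _ _)
  rw [Complex.ofReal_zero, gaussPrim_zero, sub_zero] at h
  rw [← h, ← intervalIntegral.integral_ofReal]
  simp

theorem tendsto_gaussPrim_atTop :
    Tendsto (fun x : ℝ => gaussPrim x) atTop (𝓝 ((√Real.pi / 2 : ℝ) : ℂ)) := by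
  simp only [gaussPrim_ofReal]
  refine (Complex.continuous_ofReal.tendsto _).comp ?_
  have h := intervalIntegral_tendsto_integral_Ioi 0
    (integrable_exp_neg_mul_sq one_pos).integrableOn tendsto_id
  rw [integral_gaussian_Ioi, div_one] at h
  exact h

theorem gaussPrim_neg_ofReal (x : ℝ) : gaussPrim (-(x : ℂ)) = -gaussPrim x := by
  have h := intervalIntegral.integral_comp_neg (a := 0) (b := x)
    (fun t : ℝ => Real.exp (-1 * t ^ 2))
  rw [← Complex.ofReal_neg, gaussPrim_ofReal, gaussPrim_ofReal, intervalIntegral.integral_symm]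
  simp only [neg_sq, neg_zero] at h
  rw [← h]
  push_cast
  rfl

theorem norm_gaussPrim_add_sub_le (x : ℝ) (w : ℂ) :
    ‖gaussPrim (x + w) - gaussPrim x‖ ≤ Real.exp (‖w‖ ^ 2) * ‖w‖ := by
  have hconv : Convex ℝ {z : ℂ | |z.im| ≤ ‖w‖} := by
    have : {z : ℂ | |z.im| ≤ ‖w‖} = Complex.imLm ⁻¹' Set.Icc (-‖w‖) ‖w‖ := by
      ext z
      simp [abs_le]
    rw [this]
    exact (convex_Icc _ _).linear_preimage _
  have h := hconv.norm_image_sub_le_of_norm_hasDerivWithin_le (x := (x : ℂ)) (y := x + w)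
    (fun z _ => (hasDerivAt_gaussPrim z).hasDerivWithinAt)
    (C := Real.exp (‖w‖ ^ 2)) (fun z hz => ?_) (by simp) (by simpa using Complex.abs_im_le_norm w)
  · simpa using h
  · rw [Complex.norm_exp, Real.exp_le_exp]
    have h1 : z.im ^ 2 ≤ ‖w‖ ^ 2 := sq_le_sq.mpr (by rwa [abs_norm])
    simp only [Complex.neg_re, sq, Complex.mul_re]
    nlinarith [sq_nonneg z.re]

/-- A primitive in `τ` of `2 s exp (-(s ^ 2 τ ^ 2) - y ^ 2 / (4 τ ^ 2))`. -/
noncomputable def gaussEdge (s : ℂ) (y τ : ℝ) : ℂ :=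
  Complex.exp (-(s * y)) * gaussPrim (s * τ - y / (2 * τ)) +
    Complex.exp (s * y) * gaussPrim (s * τ + y / (2 * τ))

/-- The integrand of the heat-kernel representation of `exp (-(s * |y|)) / (2 * s)`, where
`s2 = s ^ 2`. -/
noncomputable def heatWeight (s2 : ℂ) (y τ : ℝ) : ℂ :=
  Complex.exp (-(s2 * τ ^ 2) - y ^ 2 / (4 * τ ^ 2))

theorem hasDerivAt_gaussEdge (s : ℂ) (y : ℝ) {τ : ℝ} (hτ : 0 < τ) :
    HasDerivAt (gaussEdge s y) (2 * s * heatWeight (s ^ 2) y τ) τ := by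
  have hτ' : (τ : ℂ) ≠ 0 := by exact_mod_cast hτ.ne'
  have hdiv : HasDerivAt (fun z : ℂ => (y : ℂ) / (2 * z)) (-(y : ℂ) / (2 * (τ : ℂ) ^ 2)) τ := by
    have h := ((hasDerivAt_inv hτ').const_mul ((y : ℂ) / 2))
    refine (h.congr_deriv ?_).congr_of_eventuallyEq (Eventually.of_forall fun z => ?_)
    · field_simp
    · simp only
      rw [← div_eq_mul_inv, div_div]
  have hlin : HasDerivAt (fun z : ℂ => s * z) s τ := by simpa using (hasDerivAt_id (τ : ℂ)).const_mul s
  have h1 := (hasDerivAt_gaussPrim (s * τ - y / (2 * τ))).comp (τ : ℂ) (hlin.sub hdiv)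
  have h2 := (hasDerivAt_gaussPrim (s * τ + y / (2 * τ))).comp (τ : ℂ) (hlin.add hdiv)
  have h3 := ((h1.const_mul (Complex.exp (-(s * y)))).add
    (h2.const_mul (Complex.exp (s * y)))).comp_ofReal
  refine h3.congr_deriv ?_
  rw [← mul_assoc, ← mul_assoc, ← Complex.exp_add, ← Complex.exp_add]
  have e1 : -(s * y) + -(s * τ - y / (2 * τ)) ^ 2 = -(s ^ 2 * τ ^ 2) - (y : ℂ) ^ 2 / (4 * τ ^ 2) := by
    field_simp
    ring
  have e2 : s * y + -(s * τ + y / (2 * τ)) ^ 2 = -(s ^ 2 * τ ^ 2) - (y : ℂ) ^ 2 / (4 * τ ^ 2) := by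
    field_simp
    ring
  rw [e1, e2, heatWeight]
  ring

theorem measurable_heatWeight (s2 : ℂ) (y : ℝ) : Measurable (heatWeight s2 y) := by
  unfold heatWeight
  fun_prop

theorem norm_heatWeight_le (s2 : ℂ) (y τ : ℝ) :
    ‖heatWeight s2 y τ‖ ≤ Real.exp (-(s2.re * τ ^ 2)) := by
  rw [heatWeight, Complex.norm_exp, Real.exp_le_exp]
  have : (-(s2 * (τ : ℂ) ^ 2) - (y : ℂ) ^ 2 / (4 * (τ : ℂ) ^ 2)).re
      = -(s2.re * τ ^ 2) - y ^ 2 / (4 * τ ^ 2) := by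
    have h1 : s2 * (τ : ℂ) ^ 2 = s2 * ((τ ^ 2 : ℝ) : ℂ) := by push_cast; rfl
    have h2 : (y : ℂ) ^ 2 / (4 * (τ : ℂ) ^ 2) = ((y ^ 2 / (4 * τ ^ 2) : ℝ) : ℂ) := by push_cast; rfl
    rw [h1, h2, Complex.sub_re, Complex.neg_re, Complex.re_mul_ofReal, Complex.ofReal_re]
  rw [this]
  have : 0 ≤ y ^ 2 / (4 * τ ^ 2) := by positivity
  linarith

theorem integrableOn_heatWeight_Ioc (s2 : ℂ) (y : ℝ) :
    IntegrableOn (heatWeight s2 y) (Ioc 0 1) := by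
  have hc : IntegrableOn (fun τ : ℝ => Real.exp (-(s2.re * τ ^ 2))) (Ioc 0 1) :=
    (Continuous.integrableOn_Icc (by fun_prop)).mono_set Ioc_subset_Icc_self
  exact hc.mono' (measurable_heatWeight _ _).aestronglyMeasurable
    (Eventually.of_forall fun τ => norm_heatWeight_le _ _ _)

theorem tendsto_gaussPrim_add_atTop {l : Filter ℝ} {u : ℝ → ℝ} {w : ℝ → ℂ}
    (hu : Tendsto u l atTop) (hw : Tendsto w l (𝓝 0)) :
    Tendsto (fun τ => gaussPrim (u τ + w τ)) l (𝓝 ((√Real.pi / 2 : ℝ) : ℂ)) := by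
  have h1 := tendsto_gaussPrim_atTop.comp hu
  have h2 : Tendsto (fun τ => gaussPrim (u τ + w τ) - gaussPrim (u τ)) l (𝓝 0) := by
    refine squeeze_zero_norm (fun τ => norm_gaussPrim_add_sub_le (u τ) (w τ)) ?_
    have h3 : Tendsto (fun τ => ‖w τ‖) l (𝓝 0) := by simpa using hw.norm
    simpa using (Real.continuous_exp.tendsto _ |>.comp (h3.pow 2)).mul h3
  simpa using h1.add h2

theorem tendsto_gaussPrim_add_atBot {l : Filter ℝ} {u : ℝ → ℝ} {w : ℝ → ℂ}
    (hu : Tendsto u l atTop) (hw : Tendsto w l (𝓝 0)) :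
    Tendsto (fun τ => gaussPrim (w τ - u τ)) l (𝓝 (-((√Real.pi / 2 : ℝ) : ℂ))) := by
  have h1 := (tendsto_gaussPrim_atTop.comp hu).neg
  have h2 : Tendsto (fun τ => gaussPrim (w τ - u τ) - gaussPrim (-(u τ : ℂ))) l (𝓝 0) := by
    refine squeeze_zero_norm (fun τ => ?_) (?_ : Tendsto (fun τ => Real.exp (‖w τ‖ ^ 2) * ‖w τ‖) l _)
    · have := norm_gaussPrim_add_sub_le (-u τ) (w τ)
      push_cast at this
      rwa [neg_add_eq_sub] at this
    have h3 : Tendsto (fun τ => ‖w τ‖) l (𝓝 0) := by simpa using hw.norm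
    simpa using (Real.continuous_exp.tendsto _ |>.comp (h3.pow 2)).mul h3
  simp only [gaussPrim_neg_ofReal, sub_neg_eq_add] at h2
  simpa using h1.add h2

theorem tendsto_gaussEdge_zero (s : ℂ) {y : ℝ} (hy : 0 ≤ y) :
    Tendsto (gaussEdge s y) (𝓝[>] 0)
      (𝓝 ((√Real.pi / 2 : ℝ) * (Complex.exp (s * y) - Complex.exp (-(s * y))))) := by
  have hw : Tendsto (fun τ : ℝ => s * τ) (𝓝[>] 0) (𝓝 0) := by
    have : Continuous (fun τ : ℝ => s * τ) := by fun_prop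
    simpa using (this.tendsto 0).mono_left nhdsWithin_le_nhds
  rcases hy.eq_or_lt with rfl | hy
  · have hcont : ContinuousAt gaussPrim 0 := (hasDerivAt_gaussPrim 0).continuousAt
    have h1 : Tendsto (fun τ : ℝ => gaussPrim (s * τ)) (𝓝[>] 0) (𝓝 0) := by
      have := hcont.tendsto.comp hw
      rwa [gaussPrim_zero] at this
    have h2 := h1.add h1
    refine (h2.congr fun τ => ?_).trans_eq ?_ <;> simp [gaussEdge]
  · have hu : Tendsto (fun τ : ℝ => y / (2 * τ)) (𝓝[>] 0) atTop := by
      have := tendsto_inv_nhdsGT_zero (𝕜 := ℝ) |>.const_mul_atTop (half_pos hy)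
      refine this.congr fun τ => ?_
      rw [← div_eq_mul_inv, div_div]
    have h1 := (tendsto_gaussPrim_add_atBot hu hw).const_mul (Complex.exp (-(s * y)))
    have h2 := (tendsto_gaussPrim_add_atTop hu hw).const_mul (Complex.exp (s * y))
    have h3 := h1.add h2
    refine (h3.congr fun τ => ?_).trans_eq ?_
    · simp only [gaussEdge]
      push_cast
      rw [add_comm (s * (τ : ℂ)) ((y : ℂ) / (2 * τ))]
    · congr 1
      ring

theorem integral_heatWeight_Ioc (s : ℂ) {y : ℝ} (hy : 0 ≤ y) :
    2 * s * ∫ τ in Ioc (0 : ℝ) 1, heatWeight (s ^ 2) y τ = gaussEdge s y 1 -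
      (√Real.pi / 2 : ℝ) * (Complex.exp (s * y) - Complex.exp (-(s * y))) := by
  rw [← integral_const_mul, ← intervalIntegral.integral_of_le zero_le_one]
  refine intervalIntegral.integral_eq_sub_of_hasDerivAt_of_tendsto zero_lt_one
    (fun τ hτ => hasDerivAt_gaussEdge s y hτ.1) ?_ (tendsto_gaussEdge_zero s hy) ?_
  · rw [intervalIntegrable_iff_integrableOn_Ioc_of_le zero_le_one]
    exact (integrableOn_heatWeight_Ioc _ _).const_mul _
  · exact (hasDerivAt_gaussEdge s y one_pos).continuousAt.tendsto.mono_left nhdsWithin_le_nhds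

theorem integral_heatWeight_Ioi {s : ℝ} (hs : 0 < s) (y : ℝ) :
    2 * s * ∫ τ in Ioi (1 : ℝ), heatWeight ((s : ℂ) ^ 2) y τ =
      (√Real.pi / 2 : ℝ) * (Complex.exp (-(s * y)) + Complex.exp (s * y)) - gaussEdge s y 1 := by
  rw [← integral_const_mul]
  refine integral_Ioi_of_hasDerivAt_of_tendsto'
    (fun τ hτ => hasDerivAt_gaussEdge s y (one_pos.trans_le hτ)) ?_ ?_
  · have hg : IntegrableOn (fun τ : ℝ => Real.exp (-(s ^ 2) * τ ^ 2)) (Ioi 1) :=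
      (integrable_exp_neg_mul_sq (by positivity)).integrableOn
    refine Integrable.const_mul (hg.mono' (measurable_heatWeight _ _).aestronglyMeasurable
      (Eventually.of_forall fun τ => ?_)) _
    refine (norm_heatWeight_le _ _ _).trans_eq ?_
    rw [← Complex.ofReal_pow, Complex.ofReal_re, neg_mul]
  · have hu : Tendsto (fun τ : ℝ => s * τ) atTop atTop := tendsto_id.const_mul_atTop hs
    have hw : Tendsto (fun τ : ℝ => (y : ℂ) / (2 * τ)) atTop (𝓝 0) := by
      have h : Tendsto (fun τ : ℝ => y / 2 * τ⁻¹) atTop (𝓝 0) := by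
        simpa using tendsto_inv_atTop_zero.const_mul (y / 2)
      have h' := (Complex.continuous_ofReal.tendsto _).comp h
      refine (h'.congr fun τ => ?_).trans_eq (by simp)
      simp only [Function.comp]
      push_cast
      rw [← div_eq_mul_inv, div_div]
    have hw' : Tendsto (fun τ : ℝ => -((y : ℂ) / (2 * τ))) atTop (𝓝 0) := by simpa using hw.neg
    have h1 := (tendsto_gaussPrim_add_atTop hu hw').const_mul (Complex.exp (-(s * y)))
    have h2 := (tendsto_gaussPrim_add_atTop hu hw).const_mul (Complex.exp (s * y))
    refine ((h1.add h2).congr fun τ => ?_).trans_eq ?_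
    · simp only [gaussEdge]
      push_cast
      rw [sub_eq_add_neg]
    · congr 1
      ring

/-- The part of `exp (-(s * |y|)) / (2 * s)` that is not carried by the heat kernel at times
`τ ^ 2 ≤ 1`. -/
noncomputable def heatRem (s : ℂ) (y : ℝ) : ℂ :=
  Complex.exp (-(s * (|y| : ℝ))) / (2 * s) -
    (√Real.pi : ℂ)⁻¹ * ∫ τ in Ioc (0 : ℝ) 1, heatWeight (s ^ 2) y τ

theorem heatWeight_abs (s2 : ℂ) (y τ : ℝ) : heatWeight s2 |y| τ = heatWeight s2 y τ := by
  rw [heatWeight, heatWeight, ← Complex.ofReal_pow |y|, sq_abs, Complex.ofReal_pow]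

theorem gaussEdge_neg (s : ℂ) (y τ : ℝ) : gaussEdge s (-y) τ = gaussEdge s y τ := by
  simp only [gaussEdge, Complex.ofReal_neg, neg_div, mul_neg, neg_neg, sub_neg_eq_add]
  rw [add_comm, ← sub_eq_add_neg]

theorem ofReal_sqrt_pi_ne_zero : (√Real.pi : ℂ) ≠ 0 := by
  exact_mod_cast (Real.sqrt_pos.mpr Real.pi_pos).ne'

theorem heatRem_eq {s : ℂ} (hs : s ≠ 0) (y : ℝ) :
    heatRem s y = (2 * s)⁻¹ * ((Complex.exp (-(s * y)) + Complex.exp (s * y)) / 2 -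
      (√Real.pi : ℂ)⁻¹ * gaussEdge s y 1) := by
  have hpi := ofReal_sqrt_pi_ne_zero
  have habs : heatRem s y = (2 * s)⁻¹ *
      ((Complex.exp (-(s * (|y| : ℝ))) + Complex.exp (s * (|y| : ℝ))) / 2 -
      (√Real.pi : ℂ)⁻¹ * gaussEdge s |y| 1) := by
    have h := integral_heatWeight_Ioc s (abs_nonneg y)
    simp only [heatWeight_abs] at h
    have h' : ∫ τ in Ioc (0 : ℝ) 1, heatWeight (s ^ 2) y τ = (2 * s)⁻¹ * (gaussEdge s |y| 1 -
      (√Real.pi / 2 : ℝ) * (Complex.exp (s * (|y| : ℝ)) - Complex.exp (-(s * (|y| : ℝ))))) := by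
      rw [← h]
      field_simp
    rw [heatRem, h']
    push_cast
    field_simp
    ring
  rw [habs]
  rcases abs_choice y with h | h <;> rw [h]
  rw [gaussEdge_neg]
  push_cast
  simp only [mul_neg, neg_neg]
  ring

theorem analyticAt_heatRem {s : ℂ} (hs : s ≠ 0) (y : ℝ) : AnalyticAt ℝ (heatRem s) y := by
  have hF : AnalyticAt ℂ (fun z : ℂ => (2 * s)⁻¹ * ((Complex.exp (-(s * z)) + Complex.exp (s * z)) / 2 -
      (√Real.pi : ℂ)⁻¹ * (Complex.exp (-(s * z)) * gaussPrim (s * (1 : ℝ) - z / (2 * (1 : ℝ))) +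
    Complex.exp (s * z) * gaussPrim (s * (1 : ℝ) + z / (2 * (1 : ℝ)))))) (y : ℂ) := by
    refine Differentiable.analyticAt ?_ _
    have : Differentiable ℂ gaussPrim := fun w => (hasDerivAt_gaussPrim w).differentiableAt
    fun_prop
  have h := (hF.restrictScalars (𝕜 := ℝ)).comp (Complex.ofRealCLM.analyticAt y)
  refine h.congr (Eventually.of_forall fun t => ?_)
  rw [heatRem_eq hs, gaussEdge]
  rfl

theorem heatRem_eq_integral {s : ℝ} (hs : 0 < s) (y : ℝ) :
    heatRem s y = (√Real.pi : ℂ)⁻¹ * ∫ τ in Ioi (1 : ℝ), heatWeight ((s : ℂ) ^ 2) y τ := by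
  have hs' : (s : ℂ) ≠ 0 := by exact_mod_cast hs.ne'
  have h := integral_heatWeight_Ioi hs y
  have h' : ∫ τ in Ioi (1 : ℝ), heatWeight ((s : ℂ) ^ 2) y τ = (2 * (s : ℂ))⁻¹ *
      ((√Real.pi / 2 : ℝ) * (Complex.exp (-(s * y)) + Complex.exp (s * y)) - gaussEdge s y 1) := by
    rw [← h]
    field_simp
  have hpi := ofReal_sqrt_pi_ne_zero
  rw [heatRem_eq hs', h']
  push_cast
  field_simp

theorem finite_setOf_int_add_sq_lt (α B : ℝ) : {n : ℤ | ((n : ℝ) + α) ^ 2 < B}.Finite := by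
  refine (Set.finite_Icc ⌈-α - B - 1⌉ ⌊B + 1 - α⌋).subset fun n hn => ?_
  change ((n : ℝ) + α) ^ 2 < B at hn
  rw [Set.mem_Icc, Int.ceil_le, Int.le_floor]
  constructor <;> nlinarith [sq_nonneg ((n : ℝ) + α + 1), sq_nonneg ((n : ℝ) + α - 1)]

theorem summable_int_one_div_one_add_sq (α : ℝ) :
    Summable (fun n : ℤ => 1 / (1 + ((n : ℝ) + α) ^ 2)) := by
  have h := (Real.summable_one_div_int_add_rpow α 2).mpr one_lt_two
  refine Summable.of_norm_bounded_eventually h ?_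
  refine (finite_setOf_int_add_sq_lt α 1).subset fun n hn => ?_
  by_contra! hlt
  replace hlt : 1 ≤ ((n : ℝ) + α) ^ 2 := not_lt.mp hlt
  refine hn ?_
  change ‖1 / (1 + ((n : ℝ) + α) ^ 2)‖ ≤ 1 / |(n : ℝ) + α| ^ (2 : ℝ)
  rw [Real.norm_of_nonneg (by positivity), Real.rpow_two, sq_abs]
  gcongr
  linarith

theorem exp_abs_sub_sq_le (a : ℝ) : Real.exp (|a| - a ^ 2) ≤ 2 * (1 / (1 + a ^ 2)) := by
  have h1 : (1 + a ^ 2) / 2 ≤ Real.exp (a ^ 2 - |a|) := by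
    refine le_trans ?_ (Real.add_one_le_exp _)
    nlinarith [sq_nonneg (|a| - 1), sq_abs a]
  rw [← neg_sub, Real.exp_neg, mul_one_div, ← inv_div]
  exact inv_anti₀ (by positivity) h1

theorem exists_analyticOnNhd_hasSum_heatRem (α l : ℝ) {s : ℤ → ℂ} (hs : ∀ n, s n ≠ 0)
    (hsq : ∀ n : ℤ, l < ((n : ℝ) + α) ^ 2 → s n = (√(((n : ℝ) + α) ^ 2 - l) : ℝ)) :
    ∃ F : ℝ × ℝ → ℂ, AnalyticOnNhd ℝ F {x | euclNorm x < 1} ∧ ∀ x, euclNorm x < 1 →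
      HasSum (fun n : ℤ => Complex.exp (Complex.I * (((n : ℝ) + α) * x.1 : ℝ)) *
        heatRem (s n) x.2) (F x) := by
  classical
  set T : Finset ℤ := (finite_setOf_int_add_sq_lt α (l + 1)).toFinset with hT
  have hmem : ∀ n : ℤ, n ∉ T → l + 1 ≤ ((n : ℝ) + α) ^ 2 := fun n hn => by
    simpa [hT] using hn
  have hpi : 0 < √Real.pi := Real.sqrt_pos.mpr Real.pi_pos
  obtain ⟨F, hF, hFs⟩ := exists_analyticOnNhd_tsum_integral_expKernel
    (μ := volume.restrict (Ioi (1 : ℝ)))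
    (c := fun n τ => if n ∈ T then 0 else (√Real.pi : ℂ)⁻¹ *
      (Real.exp (-((((n : ℝ) + α) ^ 2 - l) * τ ^ 2)) : ℝ))
    (P := fun n _ => Complex.I * ((n : ℝ) + α : ℝ)) (Q := fun _ _ => 0)
    (S := fun _ τ => ((-(1 / (4 * τ ^ 2)) : ℝ) : ℂ))
    (f := fun n => (√Real.pi)⁻¹ * Real.exp (l + 1 + 1 / 4) *
      (2 * (1 / (1 + ((n : ℝ) + α) ^ 2))))
    (h := fun τ => Real.exp (-1 * τ ^ 2))
    (fun n => by split_ifs <;> fun_prop) (fun n => by fun_prop) (fun n => by fun_prop)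
    (fun n => by fun_prop)
    (((summable_int_one_div_one_add_sq α).mul_left 2).mul_left _) (by fun_prop)
    (integrable_exp_neg_mul_sq one_pos).integrableOn
    (fun n => by
      refine (ae_restrict_iff' measurableSet_Ioi).mpr (Eventually.of_forall fun τ hτ => ?_)
      have hτ1 : 1 < τ ^ 2 := one_lt_pow₀ hτ two_ne_zero
      split_ifs with hn
      · simp only [norm_zero, zero_mul]
        positivity
      have ha := hmem n hn
      refine le_trans ?_ (mul_le_mul_of_nonneg_right (mul_le_mul_of_nonneg_left
        (exp_abs_sub_sq_le ((n : ℝ) + α)) (by positivity)) (Real.exp_nonneg _))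
      rw [norm_mul, norm_inv, Complex.norm_real, Complex.norm_real, Real.norm_of_nonneg hpi.le,
        Real.norm_of_nonneg (Real.exp_nonneg _), mul_assoc, mul_assoc, mul_assoc,
        ← Real.exp_add, ← Real.exp_add, ← Real.exp_add]
      refine mul_le_mul_of_nonneg_left (Real.exp_le_exp.mpr ?_) (by positivity)
      have hS : ‖((-(1 / (4 * τ ^ 2)) : ℝ) : ℂ)‖ ≤ 1 / 4 := by
        rw [Complex.norm_real, norm_neg, Real.norm_of_nonneg (by positivity)]
        gcongr
        linarith
      have hP : ‖Complex.I * (((n : ℝ) + α : ℝ) : ℂ)‖ = |(n : ℝ) + α| := by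
        rw [norm_mul, Complex.norm_I, one_mul, Complex.norm_real, Real.norm_eq_abs]
      rw [hP, norm_zero]
      nlinarith)
  refine ⟨fun x => (∑ n ∈ T, Complex.exp (Complex.I * (((n : ℝ) + α) * x.1 : ℝ)) *
        heatRem (s n) x.2) + F x, ?_, fun x hx => ?_⟩
  · refine AnalyticOnNhd.add (fun x _ => Finset.analyticAt_fun_sum _ fun n _ => ?_) hF
    refine AnalyticAt.mul ?_ ((analyticAt_heatRem (hs n) x.2).comp analyticAt_snd)
    refine AnalyticAt.comp (g := Complex.exp)
      (analyticAt_cexp.restrictScalars (𝕜 := ℝ)) ?_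
    exact analyticAt_const.mul ((Complex.ofRealCLM.analyticAt _).comp
      (analyticAt_const.mul analyticAt_fst))
  · have h1 : HasSum (fun n : ℤ => if n ∈ T then
        Complex.exp (Complex.I * (((n : ℝ) + α) * x.1 : ℝ)) * heatRem (s n) x.2 else 0)
        (∑ n ∈ T, Complex.exp (Complex.I * (((n : ℝ) + α) * x.1 : ℝ)) * heatRem (s n) x.2) := by
      have := hasSum_sum_of_ne_finset_zero (L := .unconditional ℤ) (f := fun n : ℤ => if n ∈ T then
        Complex.exp (Complex.I * (((n : ℝ) + α) * x.1 : ℝ)) * heatRem (s n) x.2 else 0) (s := T)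
        (fun n hn => if_neg hn)
      rwa [Finset.sum_congr rfl fun n hn => if_pos hn] at this
    convert! h1.add (hFs x hx).1 using 2 with n
    split_ifs with hn
    · simp
    · have ha := hmem n hn
      rw [zero_add, hsq n (by linarith), heatRem_eq_integral (Real.sqrt_pos.mpr (by linarith)),
        ← integral_const_mul, ← integral_const_mul]
      refine integral_congr_ae (Eventually.of_forall fun τ => ?_)
      simp only [heatWeight, expKernel]
      rw [← Complex.ofReal_pow, Real.sq_sqrt (by linarith), mul_left_comm, mul_assoc,
        Complex.ofReal_exp, ← Complex.exp_add, ← Complex.exp_add]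
      congr 2
      push_cast
      ring

theorem analyticOnNhd_tsum_mul_pow {ι : Type*} {b : ι → ℂ} (hb : Summable (fun i => ‖b i‖))
    (e : ι → ℕ) :
    AnalyticOnNhd ℝ (fun c : ℝ => ∑' i, b i * (c : ℂ) ^ e i) (Ioo (-1) 1) := by
  have hd : DifferentiableOn ℂ (fun z : ℂ => ∑' i, b i * z ^ e i) (Metric.ball 0 1) := by
    refine Complex.differentiableOn_tsum_of_summable_norm hb (fun i => by fun_prop) Metric.isOpen_ball
      fun i z hz => ?_
    rw [norm_mul, norm_pow]
    exact mul_le_of_le_one_right (norm_nonneg _)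
      (pow_le_one₀ (norm_nonneg _) (mem_ball_zero_iff.mp hz).le)
  intro c hc
  have hc' : (c : ℂ) ∈ Metric.ball (0 : ℂ) 1 := by
    simpa [abs_lt] using hc
  exact ((hd.analyticOnNhd Metric.isOpen_ball _ hc').restrictScalars (𝕜 := ℝ)).comp
    (Complex.ofRealCLM.analyticAt c)

theorem integral_pow_mul_exp_neg_sq_div (j : ℕ) {δ : ℝ} (hδ : 0 < δ) :
    ∫ τ in (0 : ℝ)..δ, τ ^ (2 * j + 1) * Real.exp (-(δ ^ 2 / τ ^ 2)) =
      (∫ θ in (0 : ℝ)..1, θ ^ (2 * j + 1) * Real.exp (-(1 / θ ^ 2))) * (δ ^ 2) ^ (j + 1) := by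
  have h := intervalIntegral.smul_integral_comp_mul_left (a := 0) (b := 1)
    (fun τ => τ ^ (2 * j + 1) * Real.exp (-(δ ^ 2 / τ ^ 2))) δ
  rw [mul_zero, mul_one] at h
  rw [← h, smul_eq_mul, ← intervalIntegral.integral_const_mul,
    ← intervalIntegral.integral_mul_const]
  congr 1
  ext θ
  rw [mul_pow δ θ 2, ← div_div, div_self (by positivity)]
  ring

theorem integral_pow_mul_neg_sq_div_pow (j i : ℕ) {δ : ℝ} (hδ : 0 < δ) :
    ∫ τ in δ..1, τ ^ (2 * j + 1) * ((-(δ ^ 2 / τ ^ 2)) ^ i / i.factorial) =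
      if i = j + 1 then -((-1) ^ (j + 1) / (j + 1).factorial * (δ ^ 2) ^ (j + 1) * Real.log δ)
      else (-1) ^ i / i.factorial / (2 * ((j : ℝ) + 1 - i)) *
        ((δ ^ 2) ^ i - (δ ^ 2) ^ (j + 1)) := by
  have h0 : (0 : ℝ) ∉ Set.uIcc δ 1 := Set.notMem_uIcc_of_lt hδ one_pos
  have hcongr : ∫ τ in δ..1, τ ^ (2 * j + 1) * ((-(δ ^ 2 / τ ^ 2)) ^ i / i.factorial) =
      ∫ τ in δ..1, (-1) ^ i / i.factorial * (δ ^ 2) ^ i * τ ^ (2 * (j : ℤ) + 1 - 2 * i) := by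
    refine intervalIntegral.integral_congr fun τ hτ => ?_
    have hτ0 : τ ≠ 0 := fun h => h0 (h ▸ hτ)
    have e1 : τ ^ (2 * (j : ℤ) + 1 - 2 * i) = τ ^ (2 * j + 1) / (τ ^ 2) ^ i := by
      rw [zpow_sub₀ hτ0, ← pow_mul]
      norm_cast
    rw [e1, neg_pow, div_pow]
    ring
  rw [hcongr, intervalIntegral.integral_const_mul]
  split_ifs with hi
  · subst hi
    have e1 : ∀ τ : ℝ, τ ^ (2 * (j : ℤ) + 1 - 2 * ((j + 1 : ℕ) : ℤ)) = τ⁻¹ := fun τ => by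
      rw [← zpow_neg_one]
      congr 1
      push_cast
      ring
    simp only [e1]
    rw [integral_inv h0, one_div, Real.log_inv]
    ring
  · have hi' : (2 * (j : ℤ) + 1 - 2 * i) ≠ -1 := by omega
    have hne : ((j : ℝ) + 1 - i) ≠ 0 := fun h => hi (by
      have : (i : ℝ) = ((j + 1 : ℕ) : ℝ) := by push_cast; linarith
      exact_mod_cast this)
    rw [integral_zpow (Or.inr ⟨hi', h0⟩), one_zpow]
    have e1 : δ ^ (2 * (j : ℤ) + 1 - 2 * i + 1) = (δ ^ 2) ^ (j + 1) / (δ ^ 2) ^ i := by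
      rw [show 2 * (j : ℤ) + 1 - 2 * i + 1 = (2 * (j + 1) : ℕ) - (2 * i : ℕ) by push_cast; ring,
        zpow_sub₀ hδ.ne', zpow_natCast, zpow_natCast, pow_mul, pow_mul]
    rw [e1]
    have e2 : (((2 * (j : ℤ) + 1 - 2 * i : ℤ) : ℝ) + 1) = 2 * ((j : ℝ) + 1 - i) := by
      push_cast
      ring
    rw [e2]
    have : (δ ^ 2) ^ i ≠ 0 := by positivity
    field_simp

theorem norm_tsum_mul_pow_le {h : ℕ → ℝ} (hh : Summable fun j => ‖h j‖) {w τ : ℝ}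
    (hτ : τ ∈ Ioc (0 : ℝ) 1) (hw : HasSum (fun j => h j * τ ^ (2 * j + 1)) w) :
    ‖w‖ ≤ ∑' j, ‖h j‖ := by
  rw [← hw.tsum_eq]
  refine tsum_of_norm_bounded hh.hasSum fun j => ?_
  rw [norm_mul, norm_pow]
  exact mul_le_of_le_one_right (norm_nonneg _)
    (pow_le_one₀ (norm_nonneg _) (by rw [Real.norm_of_nonneg hτ.1.le]; exact hτ.2))

theorem hasSum_integral_mul_exp_near {h : ℕ → ℝ} (hh : Summable fun j => ‖h j‖) {w : ℝ → ℝ}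
    (hw : ∀ τ ∈ Ioc (0 : ℝ) 1, HasSum (fun j => h j * τ ^ (2 * j + 1)) (w τ))
    {δ : ℝ} (hδ : 0 < δ) (hδ1 : δ < 1) :
    HasSum (fun j => h j * (∫ θ in (0 : ℝ)..1, θ ^ (2 * j + 1) * Real.exp (-(1 / θ ^ 2))) *
      (δ ^ 2) ^ (j + 1)) (∫ τ in (0 : ℝ)..δ, w τ * Real.exp (-(δ ^ 2 / τ ^ 2))) := by
  have key := intervalIntegral.hasSum_integral_of_dominated_convergence (a := 0) (b := δ)
    (μ := volume) (f := fun τ => w τ * Real.exp (-(δ ^ 2 / τ ^ 2)))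
    (F := fun (j : ℕ) τ => h j * τ ^ (2 * j + 1) * Real.exp (-(δ ^ 2 / τ ^ 2)))
    (fun j _ => ‖h j‖) (fun j => by
      apply Measurable.aestronglyMeasurable
      fun_prop) ?_ (ae_of_all _ fun _ _ => hh) intervalIntegrable_const ?_
  · refine HasSum.congr_fun key fun j => ?_
    simp only [mul_assoc]
    rw [intervalIntegral.integral_const_mul, integral_pow_mul_exp_neg_sq_div j hδ]
  · refine fun j => ae_of_all _ fun τ hτ => ?_
    rw [uIoc_of_le hδ.le] at hτ
    have h1 : ‖τ ^ (2 * j + 1)‖ ≤ 1 := by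
      rw [norm_pow]
      exact pow_le_one₀ (norm_nonneg _)
        (by rw [Real.norm_of_nonneg hτ.1.le]; exact hτ.2.trans hδ1.le)
    have h2 : ‖Real.exp (-(δ ^ 2 / τ ^ 2))‖ ≤ 1 := by
      rw [Real.norm_of_nonneg (Real.exp_pos _).le, Real.exp_le_one_iff]
      exact neg_nonpos.mpr (by positivity)
    rw [mul_assoc, norm_mul, norm_mul]
    exact mul_le_of_le_one_right (norm_nonneg _) (mul_le_one₀ h1 (norm_nonneg _) h2)
  · refine ae_of_all _ fun τ hτ => ?_
    rw [uIoc_of_le hδ.le] at hτ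
    exact (hw τ ⟨hτ.1, hτ.2.trans hδ1.le⟩).mul_right _

theorem summable_norm_mul_inv_factorial {h : ℕ → ℝ} (hh : Summable fun j => ‖h j‖) :
    Summable fun p : ℕ × ℕ => ‖h p.1‖ * ((p.2.factorial : ℝ))⁻¹ := by
  have h2 : Summable fun i : ℕ => ((i.factorial : ℝ))⁻¹ := by
    simpa using (NormedSpace.expSeries_div_hasSum_exp (1 : ℝ)).summable
  exact hh.mul_of_nonneg h2 (fun _ => norm_nonneg _) (fun _ => by positivity)

theorem hasSum_integral_mul_exp_far {h : ℕ → ℝ} (hh : Summable fun j => ‖h j‖) {w : ℝ → ℝ}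
    (hw : ∀ τ ∈ Ioc (0 : ℝ) 1, HasSum (fun j => h j * τ ^ (2 * j + 1)) (w τ))
    {δ : ℝ} (hδ : 0 < δ) (hδ1 : δ < 1) :
    HasSum (fun p : ℕ × ℕ => h p.1 * ∫ τ in δ..1, τ ^ (2 * p.1 + 1) *
        ((-(δ ^ 2 / τ ^ 2)) ^ p.2 / p.2.factorial))
      (∫ τ in δ..1, w τ * Real.exp (-(δ ^ 2 / τ ^ 2))) := by
  have hS := summable_norm_mul_inv_factorial hh
  have hle : ∀ τ ∈ Ioc δ 1, ∀ p : ℕ × ℕ, ‖h p.1 * τ ^ (2 * p.1 + 1) *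
      ((-(δ ^ 2 / τ ^ 2)) ^ p.2 / p.2.factorial)‖ ≤ ‖h p.1‖ * ((p.2.factorial : ℝ))⁻¹ := by
    intro τ hτ p
    have hτ0 : 0 < τ := hδ.trans hτ.1
    have h1 : ‖τ ^ (2 * p.1 + 1)‖ ≤ 1 := by
      rw [norm_pow]
      exact pow_le_one₀ (norm_nonneg _) (by rw [Real.norm_of_nonneg hτ0.le]; exact hτ.2)
    have h2 : ‖(-(δ ^ 2 / τ ^ 2)) ^ p.2‖ ≤ 1 := by
      rw [norm_pow, norm_neg, Real.norm_of_nonneg (by positivity)]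
      refine pow_le_one₀ (by positivity) ?_
      rw [div_le_one (by positivity)]
      exact pow_le_pow_left₀ hδ.le hτ.1.le 2
    rw [norm_mul, norm_mul, norm_div, Real.norm_natCast, div_eq_mul_inv]
    refine mul_le_mul (mul_le_of_le_one_right (norm_nonneg _) h1)
      (mul_le_of_le_one_left (by positivity) h2) (by positivity) (norm_nonneg _)
  have key := intervalIntegral.hasSum_integral_of_dominated_convergence (a := δ) (b := 1)
    (μ := volume) (f := fun τ => w τ * Real.exp (-(δ ^ 2 / τ ^ 2)))
    (F := fun (p : ℕ × ℕ) τ => h p.1 * τ ^ (2 * p.1 + 1) *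
      ((-(δ ^ 2 / τ ^ 2)) ^ p.2 / p.2.factorial))
    (fun p _ => ‖h p.1‖ * ((p.2.factorial : ℝ))⁻¹) (fun p => by
      apply Measurable.aestronglyMeasurable
      fun_prop) ?_ (ae_of_all _ fun _ _ => hS) intervalIntegrable_const ?_
  · refine HasSum.congr_fun key fun p => ?_
    simp only [mul_assoc]
    rw [intervalIntegral.integral_const_mul]
  · refine fun p => ae_of_all _ fun τ hτ => ?_
    rw [uIoc_of_le hδ1.le] at hτ
    exact hle τ hτ p
  · refine ae_of_all _ fun τ hτ => ?_
    rw [uIoc_of_le hδ1.le] at hτ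
    have he : HasSum (fun i : ℕ => (-(δ ^ 2 / τ ^ 2)) ^ i / (i.factorial : ℝ))
        (Real.exp (-(δ ^ 2 / τ ^ 2))) := by
      rw [Real.exp_eq_exp_ℝ]
      exact NormedSpace.expSeries_div_hasSum_exp _
    exact (hw τ ⟨hδ.trans hτ.1, hτ.2⟩).mul he (Summable.of_norm_bounded hS (hle τ hτ))

/-- A radial integral of an odd power series in `τ` against `exp (-δ² / τ²)` is, up to a
logarithmic term, analytic in `δ²`. -/
theorem exists_analyticOnNhd_integral_mul_exp_neg_sq_div {h : ℕ → ℝ}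
    (hh : Summable fun j => ‖h j‖) {w : ℝ → ℝ} (hwm : Measurable w)
    (hw : ∀ τ ∈ Ioc (0 : ℝ) 1, HasSum (fun j => h j * τ ^ (2 * j + 1)) (w τ)) :
    ∃ a b : ℝ → ℂ, AnalyticOnNhd ℝ a (Ioo (-1) 1) ∧ AnalyticOnNhd ℝ b (Ioo (-1) 1) ∧
      ∀ δ, 0 < δ → δ < 1 → ((∫ τ in Ioc (0 : ℝ) 1, w τ * Real.exp (-(δ ^ 2 / τ ^ 2)) : ℝ) : ℂ) =
        a (δ ^ 2) + ((δ ^ 2 * Real.log δ : ℝ) : ℂ) * b (δ ^ 2) := by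
  set m : ℕ → ℝ := fun j => ∫ θ in (0 : ℝ)..1, θ ^ (2 * j + 1) * Real.exp (-(1 / θ ^ 2)) with hm
  set B : ℕ × ℕ → ℝ := fun p => if p.2 = p.1 + 1 then 0 else
    h p.1 * ((-1) ^ p.2 / p.2.factorial / (2 * ((p.1 : ℝ) + 1 - p.2))) with hB
  set d : ℕ → ℝ := fun j => h j * ((-1) ^ j / (j + 1).factorial) with hd
  have hm1 : ∀ j, ‖m j‖ ≤ 1 := by
    intro j
    have := intervalIntegral.norm_integral_le_of_norm_le_const (a := 0) (b := 1) (C := 1)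
      (f := fun θ : ℝ => θ ^ (2 * j + 1) * Real.exp (-(1 / θ ^ 2))) ?_
    · simpa [hm] using this
    · intro θ hθ
      rw [uIoc_of_le zero_le_one] at hθ
      rw [norm_mul, norm_pow, Real.norm_of_nonneg hθ.1.le,
        Real.norm_of_nonneg (Real.exp_pos _).le]
      refine mul_le_one₀ (pow_le_one₀ hθ.1.le hθ.2) (Real.exp_pos _).le ?_
      rw [Real.exp_le_one_iff]
      exact neg_nonpos.mpr (by positivity)
  have hms : Summable fun j => ‖h j * m j‖ := by
    refine Summable.of_nonneg_of_le (fun _ => norm_nonneg _) (fun j => ?_) hh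
    rw [norm_mul]
    exact mul_le_of_le_one_right (norm_nonneg _) (hm1 j)
  have hds : Summable fun j => ‖d j‖ := by
    refine Summable.of_nonneg_of_le (fun _ => norm_nonneg _) (fun j => ?_) hh
    rw [hd, norm_mul, norm_div, norm_pow, norm_neg, norm_one, one_pow, Real.norm_natCast]
    refine mul_le_of_le_one_right (norm_nonneg _) ?_
    rw [div_le_one (by positivity)]
    exact_mod_cast Nat.one_le_iff_ne_zero.mpr (Nat.factorial_ne_zero _)
  have hBs : Summable fun p => ‖B p‖ := by
    refine Summable.of_nonneg_of_le (fun _ => norm_nonneg _) (fun p => ?_)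
      (summable_norm_mul_inv_factorial hh)
    simp only [hB]
    split_ifs with hp
    · rw [norm_zero]; positivity
    · rw [norm_mul, norm_div, norm_div, norm_pow, norm_neg, norm_one, one_pow,
        Real.norm_natCast, one_div]
      refine mul_le_mul_of_nonneg_left (div_le_self (by positivity) ?_) (norm_nonneg _)
      have : (1 : ℤ) ≤ |(p.1 : ℤ) + 1 - p.2| := Int.one_le_abs (by omega)
      have : (1 : ℝ) ≤ |(p.1 : ℝ) + 1 - p.2| := by exact_mod_cast this
      rw [norm_mul, Real.norm_eq_abs ((p.1 : ℝ) + 1 - p.2)]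
      norm_num
      linarith
  have hcast : ∀ {ι : Type} {f : ι → ℝ}, (Summable fun i => ‖f i‖) →
      Summable fun i => ‖(f i : ℂ)‖ := fun hf => by simpa using hf
  refine ⟨fun c => (∑' j, ((h j * m j : ℝ) : ℂ) * (c : ℂ) ^ (j + 1)) +
    (∑' p, (B p : ℂ) * (c : ℂ) ^ p.2) - ∑' p, (B p : ℂ) * (c : ℂ) ^ (p.1 + 1),
    fun c => ∑' j, (d j : ℂ) * (c : ℂ) ^ j,
    ((analyticOnNhd_tsum_mul_pow (hcast hms) _).add
      (analyticOnNhd_tsum_mul_pow (hcast hBs) _)).sub (analyticOnNhd_tsum_mul_pow (hcast hBs) _),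
    analyticOnNhd_tsum_mul_pow (hcast hds) _, fun δ hδ hδ1 => ?_⟩
  have hsum : ∀ {ι : Type} {f : ι → ℝ} (e : ι → ℕ), (Summable fun i => ‖f i‖) →
      Summable fun i => f i * (δ ^ 2) ^ e i := fun e hf => by
    refine Summable.of_norm_bounded hf fun i => ?_
    rw [norm_mul, norm_pow, norm_pow, Real.norm_of_nonneg hδ.le]
    exact mul_le_of_le_one_right (norm_nonneg _)
      (pow_le_one₀ (by positivity) (pow_le_one₀ hδ.le hδ1.le))
  have hint : IntegrableOn (fun τ => w τ * Real.exp (-(δ ^ 2 / τ ^ 2))) (Ioc 0 1) := by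
    refine Measure.integrableOn_of_bounded (M := ∑' j, ‖h j‖) (by simp) ?_ ?_
    · apply Measurable.aestronglyMeasurable
      fun_prop
    · refine (ae_restrict_mem measurableSet_Ioc).mono fun τ hτ => ?_
      rw [norm_mul]
      refine (mul_le_of_le_one_right (norm_nonneg _) ?_).trans
        (norm_tsum_mul_pow_le hh hτ (hw τ hτ))
      rw [Real.norm_of_nonneg (Real.exp_pos _).le, Real.exp_le_one_iff]
      exact neg_nonpos.mpr (by positivity)
  have hlog : HasSum (fun p : ℕ × ℕ => if p.2 = p.1 + 1 then
      d p.1 * (δ ^ 2) ^ p.1 * (δ ^ 2 * Real.log δ) else 0)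
      ((∑' j, d j * (δ ^ 2) ^ j) * (δ ^ 2 * Real.log δ)) := by
    have hinj : Function.Injective fun j : ℕ => (j, j + 1) := fun i j hij => (Prod.ext_iff.mp hij).1
    rw [← hinj.hasSum_iff]
    · simpa [Function.comp_def] using
        ((hsum (fun j => j) hds).hasSum.mul_right (δ ^ 2 * Real.log δ))
    · rintro ⟨j, i⟩ hp
      refine if_neg fun hji => hp ⟨j, ?_⟩
      simp only at hji
      rw [hji]
  have hfar := (((hsum (fun p => p.2) hBs).hasSum.sub
    (hsum (fun p => p.1 + 1) hBs).hasSum).add hlog).unique (by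
      refine HasSum.congr_fun (hasSum_integral_mul_exp_far hh hw hδ hδ1) fun p => ?_
      rw [integral_pow_mul_neg_sq_div_pow _ _ hδ]
      simp only [hB, hd]
      split_ifs with hp
      · ring
      · ring)
  have hnear := (hasSum_integral_mul_exp_near hh hw hδ hδ1).tsum_eq
  have hsplit : ∫ τ in Ioc (0 : ℝ) 1, w τ * Real.exp (-(δ ^ 2 / τ ^ 2)) =
      (∫ τ in (0 : ℝ)..δ, w τ * Real.exp (-(δ ^ 2 / τ ^ 2))) +
        ∫ τ in δ..1, w τ * Real.exp (-(δ ^ 2 / τ ^ 2)) := by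
    rw [intervalIntegral.integral_add_adjacent_intervals,
      intervalIntegral.integral_of_le zero_le_one]
    · rw [intervalIntegrable_iff_integrableOn_Ioc_of_le hδ.le]
      exact hint.mono_set (Ioc_subset_Ioc_right hδ1.le)
    · rw [intervalIntegrable_iff_integrableOn_Ioc_of_le hδ1.le]
      exact hint.mono_set (Ioc_subset_Ioc_left hδ.le)
  rw [hsplit, ← hnear, ← hfar]
  push_cast
  ring

theorem hasSum_pow_succ_div_factorial (t : ℝ) :
    HasSum (fun j : ℕ => t ^ (j + 1) / ((j + 1).factorial : ℝ)) (Real.exp t - 1) := by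
  have h : HasSum (fun i : ℕ => t ^ i / (i.factorial : ℝ)) (Real.exp t) := by
    rw [Real.exp_eq_exp_ℝ]
    exact NormedSpace.expSeries_div_hasSum_exp _
  have hshift := (hasSum_nat_add_iff' 1).mpr h
  simpa using hshift

/-- The coefficients of the odd power series of `(exp (l τ²) - exp (-τ²)) / τ`. -/
noncomputable def jumpCoeff (l : ℝ) (j : ℕ) : ℝ :=
  (l ^ (j + 1) - (-1) ^ (j + 1)) / ((j + 1).factorial : ℝ)

/-- The difference of the heat weights for `l` and `-1`, divided by `τ`. -/
noncomputable def heatJump (l τ : ℝ) : ℝ := (Real.exp (l * τ ^ 2) - Real.exp (-τ ^ 2)) / τ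

theorem measurable_heatJump (l : ℝ) : Measurable (heatJump l) := by
  unfold heatJump
  fun_prop

theorem summable_norm_jumpCoeff (l : ℝ) : Summable fun j => ‖jumpCoeff l j‖ := by
  have h := (hasSum_pow_succ_div_factorial l).summable.sub
    (hasSum_pow_succ_div_factorial (-1)).summable
  refine Summable.congr h.norm fun j => ?_
  rw [jumpCoeff, sub_div]

theorem hasSum_jumpCoeff (l : ℝ) {τ : ℝ} (hτ : 0 < τ) :
    HasSum (fun j => jumpCoeff l j * τ ^ (2 * j + 1)) (heatJump l τ) := by
  have h := ((hasSum_pow_succ_div_factorial (l * τ ^ 2)).sub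
    (hasSum_pow_succ_div_factorial (-τ ^ 2))).div_const τ
  rw [sub_sub_sub_cancel_right] at h
  refine HasSum.congr_fun h fun j => ?_
  rw [jumpCoeff, mul_pow, neg_eq_neg_one_mul (τ ^ 2), mul_pow, ← pow_mul,
    show 2 * (j + 1) = 2 * j + 1 + 1 by ring, pow_succ τ (2 * j + 1)]
  field_simp

theorem heatJump_nonneg {l : ℝ} (hl : 0 ≤ l) {τ : ℝ} (hτ : 0 < τ) : 0 ≤ heatJump l τ := by
  refine div_nonneg (sub_nonneg.mpr (Real.exp_le_exp.mpr ?_)) hτ.le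
  nlinarith [mul_nonneg hl (sq_nonneg τ), sq_nonneg τ]

theorem heatJump_le {l : ℝ} (hl : 0 ≤ l) {τ : ℝ} (hτ : τ ∈ Ioc (0 : ℝ) 1) :
    heatJump l τ ≤ Real.exp l * (l + 1) * τ := by
  rw [heatJump, div_le_iff₀ hτ.1]
  have hτ2 : τ ^ 2 ≤ 1 := pow_le_one₀ hτ.1.le hτ.2
  have h1 : Real.exp (-τ ^ 2) = Real.exp (l * τ ^ 2) * Real.exp (-((l + 1) * τ ^ 2)) := by
    rw [← Real.exp_add]
    ring_nf
  have h2 : 1 - Real.exp (-((l + 1) * τ ^ 2)) ≤ (l + 1) * τ ^ 2 := by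
    linarith [Real.add_one_le_exp (-((l + 1) * τ ^ 2))]
  have h3 : Real.exp (l * τ ^ 2) ≤ Real.exp l :=
    Real.exp_le_exp.mpr (mul_le_of_le_one_right hl hτ2)
  calc Real.exp (l * τ ^ 2) - Real.exp (-τ ^ 2)
      = Real.exp (l * τ ^ 2) * (1 - Real.exp (-((l + 1) * τ ^ 2))) := by rw [h1]; ring
    _ ≤ Real.exp (l * τ ^ 2) * ((l + 1) * τ ^ 2) :=
        mul_le_mul_of_nonneg_left h2 (Real.exp_pos _).le
    _ ≤ Real.exp l * ((l + 1) * τ ^ 2) := mul_le_mul_of_nonneg_right h3 (by positivity)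
    _ = Real.exp l * (l + 1) * τ * τ := by ring

theorem tsum_exp_mul_gaussian (α x : ℝ) {τ : ℝ} (hτ : 0 < τ) :
    ∑' n : ℤ, Complex.exp (Complex.I * (((n : ℝ) + α) * x : ℝ)) *
        (Real.exp (-(((n : ℝ) + α) ^ 2 * τ ^ 2)) : ℂ) =
      (√Real.pi / τ : ℂ) * ∑' m : ℤ, Complex.exp (2 * Real.pi * Complex.I * m * α) *
        (Real.exp (-((x - 2 * Real.pi * m) ^ 2 / (4 * τ ^ 2))) : ℂ) := by
  have hπ : (Real.pi : ℂ) ≠ 0 := by exact_mod_cast Real.pi_ne_zero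
  have hτ' : (τ : ℂ) ≠ 0 := by exact_mod_cast hτ.ne'
  set a : ℂ := ((τ ^ 2 / Real.pi : ℝ) : ℂ) with ha
  set b : ℂ := (Complex.I * x - 2 * α * τ ^ 2) / (2 * Real.pi) with hb
  have hare : 0 < a.re := by
    rw [ha, Complex.ofReal_re]
    positivity
  have hsqrt : 1 / a ^ (1 / 2 : ℂ) = (√Real.pi / τ : ℂ) := by
    have : a ^ (1 / 2 : ℂ) = ((τ / √Real.pi : ℝ) : ℂ) := by
      rw [ha, show (1 / 2 : ℂ) = ((1 / 2 : ℝ) : ℂ) by push_cast; rfl,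
        ← Complex.ofReal_cpow (by positivity), ← Real.sqrt_eq_rpow,
        Real.sqrt_div (by positivity), Real.sqrt_sq hτ.le]
    rw [this, Complex.ofReal_div, one_div_div]
  have key := Complex.tsum_exp_neg_quadratic hare b
  rw [hsqrt] at key
  have hl : ∀ n : ℤ, Complex.exp (Complex.I * (((n : ℝ) + α) * x : ℝ)) *
      (Real.exp (-(((n : ℝ) + α) ^ 2 * τ ^ 2)) : ℂ) =
      Complex.exp (Complex.I * α * x - α ^ 2 * τ ^ 2) *
        Complex.exp (-Real.pi * a * n ^ 2 + 2 * Real.pi * b * n) := by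
    intro n
    rw [Complex.ofReal_exp, ← Complex.exp_add, ← Complex.exp_add, ha, hb]
    congr 1
    push_cast
    field_simp
    ring
  have hr : ∀ m : ℤ, Complex.exp (2 * Real.pi * Complex.I * m * α) *
      (Real.exp (-((x - 2 * Real.pi * m) ^ 2 / (4 * τ ^ 2))) : ℂ) =
      Complex.exp (Complex.I * α * x - α ^ 2 * τ ^ 2) *
        Complex.exp (-Real.pi / a * (m + Complex.I * b) ^ 2) := by
    intro m
    rw [Complex.ofReal_exp, ← Complex.exp_add, ← Complex.exp_add, ha, hb]
    congr 1
    push_cast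
    field_simp
    ring_nf
    simp only [Complex.I_sq, show Complex.I ^ 3 = -Complex.I by rw [pow_succ, Complex.I_sq]; ring,
      show Complex.I ^ 4 = 1 by rw [Complex.I_pow_four]]
    ring
  simp only [hl, hr]
  rw [tsum_mul_left, tsum_mul_left, key]
  ring

/-- The contribution of the periodic image with index `m` to the Poisson-summed heat kernel. -/
noncomputable def heatImage (l α : ℝ) (x : ℝ × ℝ) (m : ℤ) (τ : ℝ) : ℂ :=
  heatJump l τ * (Complex.exp (2 * Real.pi * Complex.I * m * α) *
    (Real.exp (-(((x.1 - 2 * Real.pi * m) ^ 2 + x.2 ^ 2) / (4 * τ ^ 2))) : ℂ))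

theorem heatWeight_sub_heatWeight (l c y : ℝ) {τ : ℝ} (hτ : 0 < τ) :
    heatWeight ((c ^ 2 - l : ℝ) : ℂ) y τ - heatWeight ((c ^ 2 + 1 : ℝ) : ℂ) y τ =
      (τ * heatJump l τ * Real.exp (-(c ^ 2 * τ ^ 2)) * Real.exp (-(y ^ 2 / (4 * τ ^ 2))) : ℝ) := by
  rw [heatJump, mul_div_cancel₀ _ hτ.ne', heatWeight, heatWeight, sub_mul, sub_mul,
    ← Real.exp_add, ← Real.exp_add, ← Real.exp_add, ← Real.exp_add]
  push_cast
  ring_nf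

theorem hasSum_integral_heatWeight_sub {l : ℝ} (hl : 0 ≤ l) (α : ℝ) (x : ℝ × ℝ) :
    HasSum (fun n : ℤ => Complex.exp (Complex.I * (((n : ℝ) + α) * x.1 : ℝ)) *
        ((√Real.pi : ℂ)⁻¹ * ((∫ τ in Ioc (0 : ℝ) 1,
            heatWeight ((((n : ℝ) + α) ^ 2 - l : ℝ) : ℂ) x.2 τ) -
          ∫ τ in Ioc (0 : ℝ) 1, heatWeight ((((n : ℝ) + α) ^ 2 + 1 : ℝ) : ℂ) x.2 τ)))
      (∫ τ in Ioc (0 : ℝ) 1, ∑' m : ℤ, heatImage l α x m τ) := by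
  set F : ℤ → ℝ → ℂ := fun n τ => Complex.exp (Complex.I * (((n : ℝ) + α) * x.1 : ℝ)) *
    ((√Real.pi : ℂ)⁻¹ * (heatWeight ((((n : ℝ) + α) ^ 2 - l : ℝ) : ℂ) x.2 τ -
      heatWeight ((((n : ℝ) + α) ^ 2 + 1 : ℝ) : ℂ) x.2 τ)) with hF
  have hint : ∀ n, Integrable (F n) (volume.restrict (Ioc 0 1)) := fun n =>
    (((integrableOn_heatWeight_Ioc _ _).sub (integrableOn_heatWeight_Ioc _ _)).const_mul
      _).const_mul _
  set C : ℝ := (√Real.pi)⁻¹ * (Real.exp l * (l + 1)) with hC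
  have hle : ∀ n, ∀ τ ∈ Ioc (0 : ℝ) 1, ‖F n τ‖ ≤ C * (1 / (1 + ((n : ℝ) + α) ^ 2)) := by
    intro n τ hτ
    have hj := heatJump_nonneg hl hτ.1
    have h0 := hτ.1
    simp only [hF]
    rw [heatWeight_sub_heatWeight _ _ _ hτ.1, norm_mul, mul_comm Complex.I,
      Complex.norm_exp_ofReal_mul_I, one_mul, norm_mul, norm_inv, Complex.norm_real,
      Complex.norm_real, Real.norm_of_nonneg (Real.sqrt_nonneg _),
      Real.norm_of_nonneg (r := τ * heatJump l τ * _ * _) (by positivity), hC, mul_assoc (√Real.pi)⁻¹]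
    refine mul_le_mul_of_nonneg_left ?_ (by positivity)
    have h1 : Real.exp (-(x.2 ^ 2 / (4 * τ ^ 2))) ≤ 1 := by
      rw [Real.exp_le_one_iff]
      exact neg_nonpos.mpr (by positivity)
    have h2 : τ ^ 2 * Real.exp (-(((n : ℝ) + α) ^ 2 * τ ^ 2)) ≤ 1 / (1 + ((n : ℝ) + α) ^ 2) := by
      rw [Real.exp_neg, ← div_eq_mul_inv, div_le_div_iff₀ (Real.exp_pos _) (by positivity)]
      have h3 := Real.add_one_le_exp (((n : ℝ) + α) ^ 2 * τ ^ 2)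
      have h4 : τ ^ 2 ≤ 1 := pow_le_one₀ hτ.1.le hτ.2
      nlinarith
    calc τ * heatJump l τ * Real.exp (-(((n : ℝ) + α) ^ 2 * τ ^ 2)) *
          Real.exp (-(x.2 ^ 2 / (4 * τ ^ 2)))
        ≤ τ * heatJump l τ * Real.exp (-(((n : ℝ) + α) ^ 2 * τ ^ 2)) :=
          mul_le_of_le_one_right (by positivity) h1
      _ ≤ τ * (Real.exp l * (l + 1) * τ) * Real.exp (-(((n : ℝ) + α) ^ 2 * τ ^ 2)) := by
          gcongr
          exact heatJump_le hl hτ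
      _ = Real.exp l * (l + 1) * (τ ^ 2 * Real.exp (-(((n : ℝ) + α) ^ 2 * τ ^ 2))) := by ring
      _ ≤ Real.exp l * (l + 1) * (1 / (1 + ((n : ℝ) + α) ^ 2)) :=
          mul_le_mul_of_nonneg_left h2 (by positivity)
  have hsum : Summable fun n => ∫ τ in Ioc (0 : ℝ) 1, ‖F n τ‖ := by
    refine Summable.of_nonneg_of_le (fun n => integral_nonneg fun _ => norm_nonneg _)
      (fun n => ?_) ((summable_int_one_div_one_add_sq α).mul_left C)
    refine (setIntegral_mono_on (hint n).norm (integrableOn_const (by simp)) measurableSet_Ioc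
      (hle n)).trans_eq ?_
    simp
  have key := hasSum_integral_of_summable_integral_norm hint hsum
  have hlim : ∫ τ in Ioc (0 : ℝ) 1, ∑' n, F n τ =
      ∫ τ in Ioc (0 : ℝ) 1, ∑' m : ℤ, heatImage l α x m τ := by
    refine setIntegral_congr_fun measurableSet_Ioc fun τ hτ => ?_
    have e1 : ∀ n, F n τ = (√Real.pi : ℂ)⁻¹ * (τ * heatJump l τ *
        Real.exp (-(x.2 ^ 2 / (4 * τ ^ 2))) : ℝ) *
        (Complex.exp (Complex.I * (((n : ℝ) + α) * x.1 : ℝ)) *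
          (Real.exp (-(((n : ℝ) + α) ^ 2 * τ ^ 2)) : ℂ)) := fun n => by
      simp only [hF]
      rw [heatWeight_sub_heatWeight _ _ _ hτ.1]
      push_cast
      ring
    have e2 : ∀ m, heatImage l α x m τ = heatJump l τ * Real.exp (-(x.2 ^ 2 / (4 * τ ^ 2))) *
        (Complex.exp (2 * Real.pi * Complex.I * m * α) *
        (Real.exp (-((x.1 - 2 * Real.pi * m) ^ 2 / (4 * τ ^ 2))) : ℂ)) := fun m => by
      rw [heatImage, add_div, neg_add, Real.exp_add]
      push_cast
      ring
    simp only [e1, e2]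
    rw [tsum_mul_left, tsum_mul_left, tsum_exp_mul_gaussian α x.1 hτ.1]
    have hτ' : (τ : ℂ) ≠ 0 := by exact_mod_cast hτ.1.ne'
    have hπ := ofReal_sqrt_pi_ne_zero
    generalize ∑' m : ℤ, Complex.exp (2 * Real.pi * Complex.I * m * α) *
      (Real.exp (-((x.1 - 2 * Real.pi * m) ^ 2 / (4 * τ ^ 2))) : ℂ) = T
    push_cast
    field_simp
  rw [hlim] at key
  refine HasSum.congr_fun key fun n => ?_
  simp only [hF]
  rw [integral_const_mul, integral_const_mul,
    integral_sub (integrableOn_heatWeight_Ioc _ _) (integrableOn_heatWeight_Ioc _ _)]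

/-- The factor of the `m`-th image term, `m ≠ 0`, that does not depend on the point. -/
noncomputable def imageCoeff (l α : ℝ) (m : ℤ) (τ : ℝ) : ℂ :=
  if m = 0 then 0 else heatJump l τ * (Complex.exp (2 * Real.pi * Complex.I * m * α) *
    (Real.exp (-(Real.pi ^ 2 * m ^ 2 / τ ^ 2)) : ℂ))

theorem measurable_imageCoeff (l α : ℝ) (m : ℤ) : Measurable (imageCoeff l α m) := by
  have := measurable_heatJump l
  unfold imageCoeff
  split_ifs
  · exact measurable_const
  · fun_prop

theorem norm_exp_two_pi_I_mul (m : ℤ) (α : ℝ) :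
    ‖Complex.exp (2 * Real.pi * Complex.I * m * α)‖ = 1 := by
  rw [show (2 * Real.pi * Complex.I * m * α : ℂ) = ((2 * Real.pi * m * α : ℝ) : ℂ) * Complex.I by
    push_cast; ring, Complex.norm_exp_ofReal_mul_I]

theorem heatImage_eq (l α : ℝ) (x : ℝ × ℝ) {m : ℤ} (hm : m ≠ 0) (τ : ℝ) :
    heatImage l α x m τ = imageCoeff l α m τ *
      expKernel ((Real.pi * m / τ ^ 2 : ℝ) : ℂ) ((-1 / (4 * τ ^ 2) : ℝ) : ℂ)
        ((-1 / (4 * τ ^ 2) : ℝ) : ℂ) x := by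
  have h : Complex.exp (((-(((x.1 - 2 * Real.pi * m) ^ 2 + x.2 ^ 2) / (4 * τ ^ 2)) : ℝ) : ℂ)) =
      Complex.exp (((-(Real.pi ^ 2 * m ^ 2 / τ ^ 2) : ℝ) : ℂ)) *
      expKernel ((Real.pi * m / τ ^ 2 : ℝ) : ℂ) ((-1 / (4 * τ ^ 2) : ℝ) : ℂ)
        ((-1 / (4 * τ ^ 2) : ℝ) : ℂ) x := by
    rw [expKernel, ← Complex.exp_add]
    congr 1
    push_cast
    ring
  rw [heatImage, imageCoeff, if_neg hm, Complex.ofReal_exp, h, Complex.ofReal_exp]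
  ring

theorem norm_heatJump_le {l : ℝ} (hl : 0 ≤ l) {τ : ℝ} (hτ : τ ∈ Ioc (0 : ℝ) 1) :
    ‖(heatJump l τ : ℂ)‖ ≤ Real.exp l * (l + 1) := by
  rw [Complex.norm_real, Real.norm_of_nonneg (heatJump_nonneg hl hτ.1)]
  exact (heatJump_le hl hτ).trans (mul_le_of_le_one_right (by positivity) hτ.2)

theorem norm_imageCoeff_mul_exp_le {l : ℝ} (hl : 0 ≤ l) (α : ℝ) (m : ℤ) {τ : ℝ}
    (hτ : τ ∈ Ioc (0 : ℝ) 1) :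
    ‖imageCoeff l α m τ‖ * Real.exp (‖((Real.pi * m / τ ^ 2 : ℝ) : ℂ)‖ +
        ‖((-1 / (4 * τ ^ 2) : ℝ) : ℂ)‖ + ‖((-1 / (4 * τ ^ 2) : ℝ) : ℂ)‖) ≤
      1 / (1 + ((m : ℝ) + 0) ^ 2) * (Real.exp l * (l + 1)) := by
  rw [imageCoeff]
  split_ifs with hm
  · rw [norm_zero, zero_mul]
    positivity
  have hτ0 := hτ.1
  have hu : 1 ≤ (τ ^ 2)⁻¹ := (one_le_inv₀ (by positivity)).mpr (pow_le_one₀ hτ.1.le hτ.2)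
  have hM : (1 : ℝ) ≤ |(m : ℝ)| := by exact_mod_cast Int.one_le_abs hm
  have hM2 : (m : ℝ) ^ 2 = |(m : ℝ)| ^ 2 := (sq_abs _).symm
  rw [norm_mul, norm_mul, norm_exp_two_pi_I_mul, one_mul, mul_assoc, mul_comm]
  simp only [Complex.norm_real, Real.norm_eq_abs, Real.abs_exp, abs_div, abs_mul, abs_pow, abs_neg,
    abs_one, abs_of_pos Real.pi_pos, abs_of_pos hτ0, Nat.abs_ofNat]
  refine mul_le_mul ?_ (by simpa using norm_heatJump_le hl hτ) (abs_nonneg _) (by positivity)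
  rw [← Real.exp_add]
  have h1 : -(Real.pi ^ 2 * (m : ℝ) ^ 2 / τ ^ 2) + (Real.pi * |(m : ℝ)| / τ ^ 2 +
      1 / (4 * τ ^ 2) + 1 / (4 * τ ^ 2)) ≤ -(m : ℝ) ^ 2 := by
    have h2 : Real.pi ^ 2 * |(m : ℝ)| ^ 2 - Real.pi * |(m : ℝ)| - 1 / 2 ≥ |(m : ℝ)| ^ 2 := by
      have hpi := Real.pi_gt_three
      nlinarith [mul_nonneg (sub_nonneg.mpr hM) (abs_nonneg (m : ℝ)),
        mul_nonneg (sub_nonneg.mpr hpi.le) (abs_nonneg (m : ℝ)),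
        mul_nonneg (mul_nonneg (sub_nonneg.mpr hpi.le) Real.pi_pos.le) (sq_nonneg |(m : ℝ)|),
        mul_nonneg Real.pi_pos.le (mul_nonneg (sub_nonneg.mpr hM) (abs_nonneg (m : ℝ))),
        mul_nonneg (sub_nonneg.mpr hpi.le) (sq_nonneg |(m : ℝ)|)]
    calc _ = -((Real.pi ^ 2 * |(m : ℝ)| ^ 2 - Real.pi * |(m : ℝ)| - 1 / 2) * (τ ^ 2)⁻¹) := by
          rw [hM2]
          ring
      _ ≤ -(|(m : ℝ)| ^ 2 * 1) := by
          refine neg_le_neg (mul_le_mul h2 hu zero_le_one (by nlinarith))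
      _ = -(m : ℝ) ^ 2 := by rw [hM2, mul_one]
  refine (Real.exp_le_exp.mpr h1).trans ?_
  rw [Real.exp_neg, ← one_div, add_zero]
  refine one_div_le_one_div_of_le (by positivity) ?_
  linarith [Real.add_one_le_exp ((m : ℝ) ^ 2)]

theorem norm_heatImage_le {l : ℝ} (hl : 0 ≤ l) (α : ℝ) {x : ℝ × ℝ} (hx : euclNorm x < 1) (m : ℤ)
    {τ : ℝ} (hτ : τ ∈ Ioc (0 : ℝ) 1) :
    ‖heatImage l α x m τ‖ ≤ 1 / (1 + ((m : ℝ) + 0) ^ 2) * (Real.exp l * (l + 1)) := by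
  by_cases hm : m = 0
  · subst hm
    rw [heatImage, norm_mul, norm_mul, norm_exp_two_pi_I_mul, one_mul, Complex.norm_real (Real.exp _),
      Real.norm_of_nonneg (Real.exp_pos _).le]
    refine (mul_le_of_le_one_right (norm_nonneg _) ?_).trans
      ((norm_heatJump_le hl hτ).trans_eq (by simp))
    rw [Real.exp_le_one_iff]
    exact neg_nonpos.mpr (by positivity)
  · rw [heatImage_eq l α x hm, norm_mul]
    exact (mul_le_mul_of_nonneg_left (norm_expKernel_le _ _ _ hx) (norm_nonneg _)).trans
      (norm_imageCoeff_mul_exp_le hl α m hτ)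

theorem measurable_heatImage (l α : ℝ) (x : ℝ × ℝ) (m : ℤ) : Measurable (heatImage l α x m) := by
  have := measurable_heatJump l
  unfold heatImage
  fun_prop

theorem exists_analyticOnNhd_integral_tsum_heatImage {l : ℝ} (hl : 0 ≤ l) (α : ℝ) :
    ∃ F : ℝ × ℝ → ℂ, AnalyticOnNhd ℝ F {x | euclNorm x < 1} ∧ ∀ x, euclNorm x < 1 →
      ∫ τ in Ioc (0 : ℝ) 1, ∑' m : ℤ, heatImage l α x m τ =
        F x + ∫ τ in Ioc (0 : ℝ) 1, heatImage l α x 0 τ := by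
  have hsum := summable_int_one_div_one_add_sq 0
  obtain ⟨F, hF, hFx⟩ := exists_analyticOnNhd_tsum_integral_expKernel
    (μ := volume.restrict (Ioc (0 : ℝ) 1)) (c := imageCoeff l α)
    (P := fun m τ => ((Real.pi * m / τ ^ 2 : ℝ) : ℂ)) (Q := fun _ τ => ((-1 / (4 * τ ^ 2) : ℝ) : ℂ))
    (S := fun _ τ => ((-1 / (4 * τ ^ 2) : ℝ) : ℂ)) (h := fun _ => Real.exp l * (l + 1))
    (measurable_imageCoeff l α) (fun _ => by fun_prop) (fun _ => by fun_prop)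
    (fun _ => by fun_prop) hsum measurable_const (integrable_const _)
    (fun m => (ae_restrict_mem measurableSet_Ioc).mono fun τ hτ =>
      norm_imageCoeff_mul_exp_le hl α m hτ)
  refine ⟨F, hF, fun x hx => ?_⟩
  have hint : ∀ m, IntegrableOn (heatImage l α x m) (Ioc 0 1) := fun m =>
    Measure.integrableOn_of_bounded (by simp) (measurable_heatImage l α x m).aestronglyMeasurable
      ((ae_restrict_mem measurableSet_Ioc).mono fun τ hτ => norm_heatImage_le hl α hx m hτ)
  have hs : Summable fun m => ∫ τ in Ioc (0 : ℝ) 1, ‖heatImage l α x m τ‖ := by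
    refine Summable.of_nonneg_of_le (fun m => integral_nonneg fun _ => norm_nonneg _)
      (fun m => ?_) (hsum.mul_right (Real.exp l * (l + 1)))
    refine (setIntegral_mono_on (hint m).norm (integrableOn_const (by simp)) measurableSet_Ioc
      fun τ hτ => norm_heatImage_le hl α hx m hτ).trans_eq ?_
    simp
  refine (hasSum_integral_of_summable_integral_norm hint hs).unique
    (((hFx x hx).1.add (hasSum_ite_eq 0 _)).congr_fun fun m => ?_)
  by_cases hm : m = 0
  · subst hm
    simp [imageCoeff]
  · simp only [heatImage_eq l α x hm, if_neg hm, add_zero]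

theorem exp_div_eq_heatRem {β s : ℂ} (hβ : β = Complex.I * s) (a y : ℝ) :
    1 / β * Complex.exp (Complex.I * (a : ℂ) + Complex.I * β * ((|y| : ℝ) : ℂ)) =
      -2 * Complex.I * (Complex.exp (Complex.I * (a : ℂ)) * (heatRem s y +
        (√Real.pi : ℂ)⁻¹ * ∫ τ in Ioc (0 : ℝ) 1, heatWeight (s ^ 2) y τ)) := by
  have h1 : Complex.I * (Complex.I * s) = -s := by
    rw [← mul_assoc, Complex.I_mul_I, neg_one_mul]
  rw [heatRem, sub_add_cancel, hβ, h1, Complex.exp_add, one_div, mul_inv, Complex.inv_I, neg_mul s]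
  ring

theorem sq_neg_I_mul_greenBeta (k α : ℝ) (n : ℤ) :
    (-Complex.I * greenBeta k α n) ^ 2 = ((((n : ℝ) + α) ^ 2 - k ^ 2 : ℝ) : ℂ) := by
  rw [mul_pow, neg_sq, Complex.I_sq, greenBeta]
  split_ifs with h
  · rw [mul_pow, Complex.I_sq, ← Complex.ofReal_pow, Real.sq_sqrt (sub_nonneg.mpr h.le)]
    ring
  · rw [← Complex.ofReal_pow, Real.sq_sqrt (sub_nonneg.mpr (not_lt.mp h))]
    push_cast
    ring

theorem euclNorm_sq (x : ℝ × ℝ) : euclNorm x ^ 2 = x.1 ^ 2 + x.2 ^ 2 :=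
  Real.sq_sqrt (by positivity)

theorem heatImage_zero (l α : ℝ) (x : ℝ × ℝ) (τ : ℝ) :
    heatImage l α x 0 τ =
      ((heatJump l τ * Real.exp (-((euclNorm x / 2) ^ 2 / τ ^ 2)) : ℝ) : ℂ) := by
  rw [heatImage, div_pow, euclNorm_sq]
  push_cast
  simp only [mul_zero, zero_mul, Complex.exp_zero, one_mul, sub_zero]
  ring_nf

theorem exists_hasSum_greenTerm_sub_greenTermI (k α : ℝ)
    (hres : ∀ n : ℤ, k ^ 2 ≠ ((n : ℝ) + α) ^ 2) :
    ∃ F : ℝ × ℝ → ℂ, AnalyticOnNhd ℝ F {x | euclNorm x < 1} ∧ ∀ x, euclNorm x < 1 →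
      HasSum (fun n : ℤ => greenTerm k α n x - greenTermI α n x)
        (-2 * Complex.I * (F x + ∫ τ in Ioc (0 : ℝ) 1, heatImage (k ^ 2) α x 0 τ)) := by
  set s : ℤ → ℂ := fun n => -Complex.I * greenBeta k α n with hs
  set σ : ℤ → ℂ := fun n => (√(((n : ℝ) + α) ^ 2 - (-1)) : ℝ) with hσ
  have hsβ : ∀ n, greenBeta k α n = Complex.I * s n := fun n => by
    rw [hs, ← mul_assoc, mul_neg, Complex.I_mul_I, neg_neg, one_mul]
  have hσγ : ∀ n, greenGamma α n = Complex.I * σ n := fun n => by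
    simp only [hσ]
    rw [greenGamma, sub_neg_eq_add, add_comm (1 : ℝ)]
  have hs2 : ∀ n, s n ^ 2 = ((((n : ℝ) + α) ^ 2 - k ^ 2 : ℝ) : ℂ) := sq_neg_I_mul_greenBeta k α
  have hσ2 : ∀ n, σ n ^ 2 = ((((n : ℝ) + α) ^ 2 + 1 : ℝ) : ℂ) := fun n => by
    simp only [hσ]
    rw [sub_neg_eq_add, ← Complex.ofReal_pow, Real.sq_sqrt (by positivity)]
  have hs0 : ∀ n, s n ≠ 0 := fun n h => by
    have h2 := hs2 n
    rw [h, zero_pow two_ne_zero] at h2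
    exact hres n (sub_eq_zero.mp (by exact_mod_cast h2.symm)).symm
  have hσ0 : ∀ n, σ n ≠ 0 := fun n h => by
    have h2 := hσ2 n
    rw [h, zero_pow two_ne_zero] at h2
    have h3 : ((n : ℝ) + α) ^ 2 + 1 = 0 := by exact_mod_cast h2.symm
    nlinarith [sq_nonneg ((n : ℝ) + α)]
  obtain ⟨F₁, hF₁, hF₁x⟩ := exists_analyticOnNhd_hasSum_heatRem α (k ^ 2) hs0 fun n hn => by
    simp only [hs]
    rw [greenBeta, if_pos hn, ← mul_assoc, neg_mul, Complex.I_mul_I, neg_neg, one_mul]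
  obtain ⟨F₂, hF₂, hF₂x⟩ := exists_analyticOnNhd_hasSum_heatRem α (-1) hσ0 fun n _ => rfl
  obtain ⟨F₃, hF₃, hF₃x⟩ := exists_analyticOnNhd_integral_tsum_heatImage (sq_nonneg k) α
  refine ⟨fun x => F₁ x - F₂ x + F₃ x, (hF₁.sub hF₂).add hF₃, fun x hx => ?_⟩
  have h := (((hF₁x x hx).sub (hF₂x x hx)).add
    (hasSum_integral_heatWeight_sub (sq_nonneg k) α x)).mul_left (-2 * Complex.I)
  rw [hF₃x x hx, ← add_assoc] at h
  refine h.congr_fun fun n => ?_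
  rw [greenTerm, greenTermI, exp_div_eq_heatRem (hsβ n), exp_div_eq_heatRem (hσγ n), hs2, hσ2]
  ring

end

/-- **Lemma A.1.** The difference `D = G_{k,α} − G_{i,α}` can be written as
`D(x) = A(x) + |x|² ln|x| · b(|x|²)` near `0`, with `A` real-analytic on a ball around `0` and
`b` analytic in a neighborhood of `0`. -/
theorem greenDiff_decomposition
    (k α : ℝ) (hk : 0 < k)
    (hres : ∀ n : ℤ, k ^ 2 ≠ ((n : ℝ) + α) ^ 2) :
    ∃ r : ℝ, 0 < r ∧ ∃ A : ℝ × ℝ → ℂ, ∃ b : ℝ → ℂ,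
      AnalyticOnNhd ℝ A {x : ℝ × ℝ | euclNorm x < r} ∧
      AnalyticAt ℝ b 0 ∧
      ∀ x : ℝ × ℝ, 0 < euclNorm x → euclNorm x < r →
        greenDiff k α x =
          A x + ((euclNorm x ^ 2 * Real.log (euclNorm x) : ℝ) : ℂ) * b (euclNorm x ^ 2) := by
  obtain ⟨F, hF, hFx⟩ := exists_hasSum_greenTerm_sub_greenTermI k α hres
  obtain ⟨a, b, ha, hb, hab⟩ := exists_analyticOnNhd_integral_mul_exp_neg_sq_div
    (summable_norm_jumpCoeff (k ^ 2)) (measurable_heatJump (k ^ 2))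
    fun τ hτ => hasSum_jumpCoeff (k ^ 2) hτ.1
  have hπ : (Real.pi : ℂ) ≠ 0 := by exact_mod_cast Real.pi_ne_zero
  refine ⟨1, one_pos, fun x => (2 * Real.pi : ℂ)⁻¹ * (F x + a ((x.1 ^ 2 + x.2 ^ 2) / 4) -
      ((x.1 ^ 2 + x.2 ^ 2 : ℝ) : ℂ) * (Real.log 2 / 4 * b ((x.1 ^ 2 + x.2 ^ 2) / 4))),
    fun t => (8 * Real.pi : ℂ)⁻¹ * b (t / 4), fun x hx => ?_, ?_, fun x hx0 hx => ?_⟩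
  · have hρ : AnalyticAt ℝ (fun x : ℝ × ℝ => x.1 ^ 2 + x.2 ^ 2) x :=
      (analyticAt_fst.pow 2).add (analyticAt_snd.pow 2)
    have hρ4 : AnalyticAt ℝ (fun x : ℝ × ℝ => (x.1 ^ 2 + x.2 ^ 2) / 4) x := hρ.div_const
    have hmem : (x.1 ^ 2 + x.2 ^ 2) / 4 ∈ Set.Ioo (-1 : ℝ) 1 := by
      have h1 : euclNorm x < 1 := hx
      have h2 : 0 ≤ euclNorm x := Real.sqrt_nonneg _
      rw [← euclNorm_sq]
      constructor <;> nlinarith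
    have ha' := AnalyticAt.comp (f := fun x : ℝ × ℝ => (x.1 ^ 2 + x.2 ^ 2) / 4) (ha _ hmem) hρ4
    have hb' := AnalyticAt.comp (f := fun x : ℝ × ℝ => (x.1 ^ 2 + x.2 ^ 2) / 4) (hb _ hmem) hρ4
    exact analyticAt_const.mul (((hF x hx).add ha').sub
      (((Complex.ofRealCLM.analyticAt _).comp hρ).mul (analyticAt_const.mul hb')))
  · exact analyticAt_const.mul (AnalyticAt.comp (f := fun t : ℝ => t / 4)
      (hb _ (by norm_num)) analyticAt_id.div_const)
  · have hint : ∫ τ in Set.Ioc (0 : ℝ) 1, heatImage (k ^ 2) α x 0 τ = _ :=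
      (integral_congr_ae (Filter.Eventually.of_forall fun τ =>
        heatImage_zero (k ^ 2) α x τ)).trans (integral_ofReal.trans
          (hab (euclNorm x / 2) (by linarith) (by linarith)))
    beta_reduce
    rw [greenDiff, (hFx x hx).tsum_eq, hint, Real.log_div hx0.ne' two_ne_zero, div_pow,
      show (2 : ℝ) ^ 2 = 4 by norm_num, ← euclNorm_sq]
    push_cast
    field_simp
    ring_nf
    simp only [Complex.I_sq]
    ring
end
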